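/- arXiv:1105.5471 — 3 statements merged into one kernel-verified Lean document; each statement's English description precedes it below -/
import Mathlib

section
/- Let a be an amplitude of order m′, let μ₀ > 0 be such that a(s,x,y,p,σ) = 0 whenever |p₁| > μ₀/2, and let ρ : ℝ → ℝ be smooth and compactly supported with ρ ≡ 1 on [−μ₀/2, μ₀/2] and supp ρ ⊆ [−μ₀, μ₀]. Then for every N ≥ 0 there is a constant C = C(N) such that for all ħ ∈ (0,1] and all x ∈ ℝ^n: | u_ħ(x,x) − (2πħ)^{−n} ∫_{ℝ×ℝ^n×ℝ} e^{−iħ^{−1} s p₁ + isσ} a(s,x,x,p,σ) ρ(ħσ) ds dp dσ | ≤ C ħ^N, the latter integral being absolutely convergent (since ρ(ħσ) vanishes for |σ| > μ₀/ħ). In other words, inserting the cutoff ρ(ħσ) changes u_ħ(x,x) only by O(ħ^∞), uniformly in x. -/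
open MeasureTheory Real

noncomputable section

/-- An *amplitude of order `m'`* in dimension `n+1`: a smooth function
`a(s,x,y,p,σ)`, compactly supported in `(s,x,y,p)`, satisfying symbol estimates
of order `m'` in `σ`. -/
def IsAmplitude (n : ℕ) (m' : ℝ)
    (a : (ℝ × (Fin (n+1) → ℝ) × (Fin (n+1) → ℝ) × (Fin (n+1) → ℝ)) → ℝ → ℂ) : Prop :=
  ContDiff ℝ (⊤ : ℕ∞)
      (fun q : (ℝ × (Fin (n+1) → ℝ) × (Fin (n+1) → ℝ) × (Fin (n+1) → ℝ)) × ℝ => a q.1 q.2) ∧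
  (∃ K : Set (ℝ × (Fin (n+1) → ℝ) × (Fin (n+1) → ℝ) × (Fin (n+1) → ℝ)),
      IsCompact K ∧ ∀ w σ, w ∉ K → a w σ = 0) ∧
  ∀ k γ : ℕ, ∃ C : ℝ,
    ∀ w σ, ‖iteratedFDeriv ℝ k (fun w' => iteratedDeriv γ (a w') σ) w‖
      ≤ C * (1 + |σ|) ^ (m' - (γ : ℝ))

/-- The operator `1 + D_s²` where `D_s = -i ∂/∂s`, i.e. `f ↦ f - f''`. -/
def oneAddDsq (f : ℝ → ℂ) : ℝ → ℂ := fun s => f s - deriv (deriv f) s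

/-- The regularized integrand defining `u_ℏ`. -/
def oscIntegrand (n : ℕ)
    (a : (ℝ × (Fin (n+1) → ℝ) × (Fin (n+1) → ℝ) × (Fin (n+1) → ℝ)) → ℝ → ℂ)
    (ℏ : ℝ) (x y : Fin (n+1) → ℝ) (K : ℕ) :
    ℝ × (Fin (n+1) → ℝ) × ℝ → ℂ :=
  fun q =>
    Complex.exp (Complex.I *
        Complex.ofReal (ℏ⁻¹ * (∑ i, (x i - y i) * q.2.1 i) + q.1 * q.2.2)) *
    (Complex.ofReal (1 + q.2.2 ^ 2))⁻¹ ^ K *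
    (oneAddDsq^[K]
        (fun s => Complex.exp (-Complex.I * Complex.ofReal (ℏ⁻¹ * s * q.2.1 0)) *
          a (s, x, y, q.2.1) q.2.2)) q.1

/-- The kernel `u_ℏ(x,y)`, defined by the regularized oscillatory integral with
the choice `K = ⌈m'/2 + 1⌉₊` (any integer `K ≥ m'/2 + 1` gives the same value). -/
def uh (n : ℕ) (m' : ℝ)
    (a : (ℝ × (Fin (n+1) → ℝ) × (Fin (n+1) → ℝ) × (Fin (n+1) → ℝ)) → ℝ → ℂ)
    (ℏ : ℝ) (x y : Fin (n+1) → ℝ) : ℂ :=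
  Complex.ofReal ((2 * π * ℏ) ^ (-((n : ℤ) + 1))) *
    ∫ q, oscIntegrand n a ℏ x y (⌈m' / 2 + 1⌉₊) q

/-- The cutoff integrand `e^{−iℏ⁻¹ s p₁ + isσ} a(s,x,x,p,σ) ρ(ℏσ)` as a function
of `(s,p,σ)`. -/
def cutoffIntegrand (n : ℕ)
    (a : (ℝ × (Fin (n+1) → ℝ) × (Fin (n+1) → ℝ) × (Fin (n+1) → ℝ)) → ℝ → ℂ)
    (ρ : ℝ → ℝ) (ℏ : ℝ) (x : Fin (n+1) → ℝ) : ℝ × (Fin (n+1) → ℝ) × ℝ → ℂ :=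
  fun q =>
    Complex.exp (Complex.I * Complex.ofReal (-(ℏ⁻¹) * q.1 * q.2.1 0 + q.1 * q.2.2)) *
    a (q.1, x, x, q.2.1) q.2.2 * Complex.ofReal (ρ (ℏ * q.2.2))

lemma aux_ibp (f : ℝ → ℂ) (hf : ContDiff ℝ 1 f) (hc : HasCompactSupport f) (t : ℝ) :
    ∫ s : ℝ, Complex.exp (Complex.I * ((s * t : ℝ) : ℂ)) * deriv f s =
      -(Complex.I * t) * ∫ s : ℝ, Complex.exp (Complex.I * ((s * t : ℝ) : ℂ)) * f s := by
  have hd : ∀ s : ℝ, HasDerivAt (fun s : ℝ => Complex.exp (Complex.I * ((s * t : ℝ) : ℂ)))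
      (Complex.I * t * Complex.exp (Complex.I * ((s * t : ℝ) : ℂ))) s := by
    intro s
    have h1 : HasDerivAt (fun s : ℝ => ((s * t : ℝ) : ℂ)) ((1 * t : ℝ) : ℂ) s :=
      ((hasDerivAt_id s).mul_const t).ofReal_comp
    have h2 := (h1.const_mul Complex.I).cexp
    convert h2 using 1
    push_cast
    ring
  have hce : Continuous (fun s : ℝ => Complex.exp (Complex.I * ((s * t : ℝ) : ℂ))) := by
    fun_prop
  have hcf := hf.continuous
  have hcd : Continuous (deriv f) := hf.continuous_deriv le_rfl
  have h := integral_mul_deriv_eq_deriv_mul_of_integrable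
    (u := fun s : ℝ => Complex.exp (Complex.I * ((s * t : ℝ) : ℂ)))
    (u' := fun s : ℝ => Complex.I * t * Complex.exp (Complex.I * ((s * t : ℝ) : ℂ)))
    (v := f) (v' := deriv f) (fun s _ => hd s)
    (fun s _ => (hf.differentiable one_ne_zero s).hasDerivAt)
    ((hce.mul hcd).integrable_of_hasCompactSupport (hc.deriv.mul_left))
    (((continuous_const.mul hce).mul hcf).integrable_of_hasCompactSupport (hc.mul_left))
    ((hce.mul hcf).integrable_of_hasCompactSupport (hc.mul_left))
  rw [h, ← integral_const_mul, ← integral_neg]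
  congr 1
  ext s
  ring

lemma aux_ibp_iter (j : ℕ) : ∀ (f : ℝ → ℂ) (_ : ContDiff ℝ (⊤ : ℕ∞) f)
    (_ : HasCompactSupport f) (t : ℝ),
    ∫ s : ℝ, Complex.exp (Complex.I * ((s * t : ℝ) : ℂ)) * iteratedDeriv j f s =
      (-(Complex.I * t)) ^ j * ∫ s : ℝ, Complex.exp (Complex.I * ((s * t : ℝ) : ℂ)) * f s := by
  induction j with
  | zero => intro f hf hc t; simp
  | succ j ih =>
    intro f hf hc t
    have hf' : ContDiff ℝ (⊤ : ℕ∞) (deriv f) := (contDiff_infty_iff_deriv.1 hf).2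
    rw [iteratedDeriv_succ', ih (deriv f) hf' hc.deriv t,
      aux_ibp f (hf.of_le (by exact_mod_cast le_top)) hc t]
    ring

lemma aux_contDiff_oneAddDsq (f : ℝ → ℂ) (hf : ContDiff ℝ (⊤ : ℕ∞) f) :
    ContDiff ℝ (⊤ : ℕ∞) (oneAddDsq f) := by
  have hf' : ContDiff ℝ (⊤ : ℕ∞) (deriv f) := (contDiff_infty_iff_deriv.1 hf).2
  exact hf.sub (contDiff_infty_iff_deriv.1 hf').2

lemma aux_supp_oneAddDsq (f : ℝ → ℂ) (hc : HasCompactSupport f) :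
    HasCompactSupport (oneAddDsq f) := hc.sub hc.deriv.deriv

lemma aux_ibp_K (K : ℕ) : ∀ (f : ℝ → ℂ) (_ : ContDiff ℝ (⊤ : ℕ∞) f)
    (_ : HasCompactSupport f) (t : ℝ),
    ∫ s : ℝ, Complex.exp (Complex.I * ((s * t : ℝ) : ℂ)) * (oneAddDsq^[K] f) s =
      (Complex.ofReal (1 + t ^ 2)) ^ K *
        ∫ s : ℝ, Complex.exp (Complex.I * ((s * t : ℝ) : ℂ)) * f s := by
  induction K with
  | zero => intro f hf hc t; simp
  | succ j ih =>
    intro f hf hc t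
    rw [Function.iterate_succ_apply, ih _ (aux_contDiff_oneAddDsq f hf)
      (aux_supp_oneAddDsq f hc) t]
    have hf' : ContDiff ℝ (⊤ : ℕ∞) (deriv f) := (contDiff_infty_iff_deriv.1 hf).2
    have hf'' : ContDiff ℝ (⊤ : ℕ∞) (deriv (deriv f)) := (contDiff_infty_iff_deriv.1 hf').2
    have hce : Continuous (fun s : ℝ => Complex.exp (Complex.I * ((s * t : ℝ) : ℂ))) := by
      fun_prop
    have key : ∫ s : ℝ, Complex.exp (Complex.I * ((s * t : ℝ) : ℂ)) * oneAddDsq f s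
        = (Complex.ofReal (1 + t ^ 2)) *
        ∫ s : ℝ, Complex.exp (Complex.I * ((s * t : ℝ) : ℂ)) * f s := by
      unfold oneAddDsq
      simp_rw [mul_sub]
      have hi1 : Integrable (fun s : ℝ => Complex.exp (Complex.I * ((s * t : ℝ) : ℂ)) * f s) :=
        (hce.mul hf.continuous).integrable_of_hasCompactSupport hc.mul_left
      have hi2 : Integrable (fun s : ℝ => Complex.exp (Complex.I * ((s * t : ℝ) : ℂ)) *
          deriv (deriv f) s) :=
        (hce.mul hf''.continuous).integrable_of_hasCompactSupport hc.deriv.deriv.mul_left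
      rw [integral_sub hi1 hi2,
        aux_ibp (deriv f) (hf'.of_le (by exact_mod_cast le_top)) hc.deriv t,
        aux_ibp f (hf.of_le (by exact_mod_cast le_top)) hc t]
      push_cast
      linear_combination (-(t:ℂ)^2 * ∫ s : ℝ, Complex.exp (Complex.I * ((s:ℂ) * (t:ℂ))) * f s) *
        Complex.I_sq
    rw [key]
    ring

/-- flatness of `1 - ρ` -/
lemma aux_flat (c : ℝ) (hc : 0 < c) (M : ℕ) : ∀ (g : ℝ → ℝ) (_ : ContDiff ℝ (⊤ : ℕ∞) g)
    (_ : ∀ j : ℕ, ∃ B : ℝ, ∀ t, |iteratedDeriv j g t| ≤ B)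
    (_ : ∀ t ∈ Set.Icc (-c) c, g t = 0),
    ∃ C : ℝ, 0 ≤ C ∧ ∀ t, ∀ p ∈ Set.Icc (-c) c, |g t| ≤ C * |t - p| ^ M := by
  induction M with
  | zero =>
    intro g hg hB hz
    obtain ⟨B, hB⟩ := hB 0
    refine ⟨B, (abs_nonneg _).trans (hB 0), fun t p hp => ?_⟩
    simpa using hB t
  | succ M ih =>
    intro g hg hB hz
    have hg' : ContDiff ℝ (⊤ : ℕ∞) (deriv g) := (contDiff_infty_iff_deriv.1 hg).2
    obtain ⟨C, hC0, hC⟩ := ih (deriv g) hg' (fun j => by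
        obtain ⟨B, hB⟩ := hB (j + 1)
        exact ⟨B, fun t => by simpa [iteratedDeriv_succ'] using hB t⟩) (by
        have h1 : Set.EqOn (deriv g) (fun _ => 0) (Set.Ioo (-c) c) := by
          intro t ht
          have : g =ᶠ[nhds t] fun _ => 0 := by
            filter_upwards [Ioo_mem_nhds ht.1 ht.2] with y hy
            exact hz y ⟨hy.1.le, hy.2.le⟩
          simpa using this.deriv_eq
        have h2 := h1.closure hg'.continuous continuous_const
        rw [closure_Ioo (by linarith)] at h2
        exact h2)
    refine ⟨C, hC0, fun t p hp => ?_⟩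
    have h := (convex_uIcc p t).norm_image_sub_le_of_norm_deriv_le (f := g)
      (C := C * |t - p| ^ M)
      (fun x _ => (contDiff_infty_iff_deriv.1 hg).1 x) (fun x hx => by
        refine (hC x p hp).trans ?_
        gcongr ?_ * ?_ ^ M
        exact Set.abs_sub_left_of_mem_uIcc hx)
      Set.left_mem_uIcc Set.right_mem_uIcc
    rw [hz p hp, sub_zero, Real.norm_eq_abs, Real.norm_eq_abs] at h
    rw [pow_succ, ← mul_assoc]
    exact h

lemma aux_partial {F : Type*} [NormedAddCommGroup F] [NormedSpace ℝ F] (G : ℝ × F → ℂ)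
    (hG : ContDiff ℝ (⊤ : ℕ∞) G) :
    ContDiff ℝ (⊤ : ℕ∞) (fun q : ℝ × F => deriv (fun s => G (s, q.2)) q.1) := by
  have h : (fun q : ℝ × F => deriv (fun s => G (s, q.2)) q.1) =
      fun q => fderiv ℝ G q ((1 : ℝ), (0 : F)) := by
    ext q
    have h1 : HasFDerivAt G (fderiv ℝ G q) (q.1, q.2) :=
      (hG.differentiable (by simp) q).hasFDerivAt
    have h2 : HasDerivAt (fun s : ℝ => (s, q.2)) ((1 : ℝ), (0 : F)) q.1 :=
      (hasDerivAt_id q.1).prodMk (hasDerivAt_const _ _)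
    exact (h1.comp_hasDerivAt q.1 h2).deriv
  rw [h]
  exact (hG.fderiv_right (m := (⊤ : ℕ∞)) (by simp)).clm_apply contDiff_const

lemma aux_exp_iter (c : ℂ) (i : ℕ) :
    iteratedDeriv i (fun s : ℝ => Complex.exp (c * s)) =
      fun s : ℝ => c ^ i * Complex.exp (c * s) := by
  induction i with
  | zero => simp
  | succ i ih =>
    rw [iteratedDeriv_succ, ih]
    ext s
    have h1 : HasDerivAt (fun s : ℝ => (s : ℂ)) ((1 : ℝ) : ℂ) s := (hasDerivAt_id s).ofReal_comp
    have h2 := ((h1.const_mul c).cexp.const_mul (c ^ i)).deriv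
    rw [h2]
    push_cast
    ring

def AuxGood (n : ℕ) (m' R : ℝ) (G : ℝ × (Fin (n+1) → ℝ) × ℝ → ℂ) : Prop :=
  ContDiff ℝ (⊤ : ℕ∞) G ∧ (∀ q, R < |q.1| → G q = 0) ∧ (∀ q, R < ‖q.2.1‖ → G q = 0) ∧
  ∀ j : ℕ, ∃ C : ℝ, ∀ q : ℝ × (Fin (n+1) → ℝ) × ℝ,
    ‖iteratedDeriv j (fun s => G (s, q.2)) q.1‖ ≤ C * (1 + |q.2.2|) ^ m'

lemma aux_iter_zero (R : ℝ) (f : ℝ → ℂ) (hf : ∀ s, R < |s| → f s = 0) (j : ℕ) (s : ℝ)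
    (hs : R < |s|) : iteratedDeriv j f s = 0 := by
  have : f =ᶠ[nhds s] fun _ => 0 := by
    have : {y : ℝ | R < |y|} ∈ nhds s := (isOpen_lt continuous_const continuous_abs).mem_nhds hs
    filter_upwards [this] with y hy
    exact hf y hy
  rw [this.iteratedDeriv_eq]
  simp

lemma aux_good_T (n : ℕ) (m' R : ℝ) (G : ℝ × (Fin (n+1) → ℝ) × ℝ → ℂ) (hG : AuxGood n m' R G) :
    AuxGood n m' R (fun q => oneAddDsq (fun s => G (s, q.2)) q.1) := by
  obtain ⟨h1, h2, h3, h4⟩ := hG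
  refine ⟨?_, ?_, ?_, ?_⟩
  · exact h1.sub (aux_partial _ (aux_partial G h1))
  · intro q hq
    have := aux_iter_zero R (fun s => G (s, q.2)) (fun s hs => h2 _ hs) 2 q.1 hq
    simp only [oneAddDsq]
    rw [iteratedDeriv_succ, iteratedDeriv_one] at this
    rw [this, sub_zero]
    exact h2 q hq
  · intro q hq
    have : (fun s => G (s, q.2)) = fun _ => 0 := by
      ext s
      exact h3 _ hq
    simp only [oneAddDsq, this]
    simpa using h3 q hq
  · intro j
    obtain ⟨C, hC⟩ := h4 j
    obtain ⟨D, hD⟩ := h4 (j + 2)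
    refine ⟨C + D, fun q => ?_⟩
    have hf : ContDiff ℝ (⊤ : ℕ∞) (fun s => G (s, q.2)) :=
      h1.comp (contDiff_id.prodMk contDiff_const)
    have hf' := (contDiff_infty_iff_deriv.1 hf).2
    have hf'' := (contDiff_infty_iff_deriv.1 hf').2
    have : iteratedDeriv j (fun s => oneAddDsq (fun s => G (s, q.2)) s) q.1 =
        iteratedDeriv j (fun s => G (s, q.2)) q.1 -
          iteratedDeriv (j + 2) (fun s => G (s, q.2)) q.1 := by
      simp only [oneAddDsq]
      rw [iteratedDeriv_fun_sub (hf.contDiffAt.of_le (by exact_mod_cast le_top))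
        (hf''.contDiffAt.of_le (by exact_mod_cast le_top)), iteratedDeriv_succ',
        iteratedDeriv_succ']
    refine (le_of_eq (congrArg norm this)).trans ?_
    refine (norm_sub_le _ _).trans ?_
    rw [add_mul]
    exact add_le_add (hC q) (hD q)

lemma aux_good_T_iter (n : ℕ) (m' R : ℝ) (G : ℝ × (Fin (n+1) → ℝ) × ℝ → ℂ)
    (hG : AuxGood n m' R G) (K : ℕ) :
    AuxGood n m' R (fun q => (oneAddDsq^[K] (fun s => G (s, q.2))) q.1) := by
  induction K with
  | zero => exact hG
  | succ K ih =>
    have := aux_good_T n m' R _ ih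
    simp only [Function.iterate_succ_apply']
    exact this

lemma aux_amp_bound (n : ℕ) (m' : ℝ)
    (a : (ℝ × (Fin (n+1) → ℝ) × (Fin (n+1) → ℝ) × (Fin (n+1) → ℝ)) → ℝ → ℂ)
    (ha : IsAmplitude n m' a) (j : ℕ) : ∃ C : ℝ, 0 ≤ C ∧ ∀ x p σ s,
      ‖iteratedDeriv j (fun s => a (s, x, x, p) σ) s‖ ≤ C * (1 + |σ|) ^ m' := by
  obtain ⟨h1, -, h3⟩ := ha
  obtain ⟨C, hC⟩ := h3 j 0
  refine ⟨|C|, abs_nonneg _, fun x p σ s => ?_⟩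
  have hb := hC (s, x, x, p) σ
  simp only [iteratedDeriv_zero, Nat.cast_zero, sub_zero] at hb
  let E := Fin (n+1) → ℝ
  let w0 : ℝ × E × E × E := (0, x, x, p)
  have hs : ContDiff ℝ (⊤ : ℕ∞) (fun w : ℝ × E × E × E => a (w + w0) σ) :=
    h1.comp ((contDiff_id.add contDiff_const).prodMk contDiff_const)
  have e1 : (fun s => a (s, x, x, p) σ) =
      (fun w : ℝ × E × E × E => a (w + w0) σ) ∘ (ContinuousLinearMap.inl ℝ ℝ (E × E × E)) := by
    ext s
    simp [w0]
  rw [← norm_iteratedFDeriv_eq_norm_iteratedDeriv, e1,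
    ContinuousLinearMap.iteratedFDeriv_comp_right _ hs s (i := j) (by exact_mod_cast le_top)]
  refine (ContinuousMultilinearMap.norm_compContinuousLinearMap_le _ _).trans ?_
  have h2 : iteratedFDeriv ℝ j (fun w : ℝ × E × E × E => a (w + w0) σ)
      ((ContinuousLinearMap.inl ℝ ℝ (E × E × E)) s) =
      iteratedFDeriv ℝ j (fun w' => a w' σ) (s, x, x, p) := by
    rw [iteratedFDeriv_comp_add_right (f := fun w => a w σ)]
    congr 1
    simp [w0]
  rw [h2]
  have h4 : ∏ _i : Fin j, ‖ContinuousLinearMap.inl ℝ ℝ (E × E × E)‖ ≤ 1 :=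
    Finset.prod_le_one (fun _ _ => norm_nonneg _)
      (fun _ _ => ContinuousLinearMap.norm_inl_le_one ℝ ℝ (E × E × E))
  calc _ ≤ ‖iteratedFDeriv ℝ j (fun w' => a w' σ) (s, x, x, p)‖ * 1 := by gcongr
    _ ≤ C * (1 + |σ|) ^ m' := by rw [mul_one]; exact hb
    _ ≤ _ := by
      gcongr
      exact le_abs_self C

lemma aux_amp_supp (n : ℕ) (m' : ℝ)
    (a : (ℝ × (Fin (n+1) → ℝ) × (Fin (n+1) → ℝ) × (Fin (n+1) → ℝ)) → ℝ → ℂ)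
    (ha : IsAmplitude n m' a) : ∃ R : ℝ, 0 < R ∧ ∀ x p σ s,
      (R < |s| ∨ R < ‖p‖) → a (s, x, x, p) σ = 0 := by
  obtain ⟨-, ⟨K, hK, h⟩, -⟩ := ha
  obtain ⟨R, hR, hR'⟩ := hK.isBounded.exists_pos_norm_le
  refine ⟨R, hR, fun x p σ s hs => h _ _ fun hmem => ?_⟩
  have := hR' _ hmem
  simp only [Prod.norm_def, sup_le_iff, Real.norm_eq_abs] at this
  rcases hs with hs | hs
  · linarith [this.1]
  · linarith [this.2.2.2]

lemma aux_slice_smooth (n : ℕ) (m' : ℝ)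
    (a : (ℝ × (Fin (n+1) → ℝ) × (Fin (n+1) → ℝ) × (Fin (n+1) → ℝ)) → ℝ → ℂ)
    (ha : IsAmplitude n m' a) (x : Fin (n+1) → ℝ) :
    ContDiff ℝ (⊤ : ℕ∞) (fun q : ℝ × (Fin (n+1) → ℝ) × ℝ => a (q.1, x, x, q.2.1) q.2.2) := by
  refine ha.1.comp (f := fun q : ℝ × (Fin (n+1) → ℝ) × ℝ => ((q.1, x, x, q.2.1), q.2.2)) ?_
  fun_prop

lemma aux_good_exp (n : ℕ) (m' R : ℝ) (hR : 0 < R)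
    (a : (ℝ × (Fin (n+1) → ℝ) × (Fin (n+1) → ℝ) × (Fin (n+1) → ℝ)) → ℝ → ℂ)
    (ha : IsAmplitude n m' a)
    (hsupp : ∀ x p σ s, (R < |s| ∨ R < ‖p‖) → a (s, x, x, p) σ = 0)
    (ℏ : ℝ) (x : Fin (n+1) → ℝ) :
    AuxGood n m' R (fun q => Complex.exp (-Complex.I * Complex.ofReal (ℏ⁻¹ * q.1 * q.2.1 0)) *
          a (q.1, x, x, q.2.1) q.2.2) := by
  have hsm := aux_slice_smooth n m' a ha x
  refine ⟨?_, ?_, ?_, ?_⟩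
  · refine ContDiff.mul ?_ hsm
    refine Complex.contDiff_exp.comp (contDiff_const.mul (Complex.ofRealCLM.contDiff.comp ?_))
    have hp0 : ContDiff ℝ (⊤ : ℕ∞) (fun q : ℝ × (Fin (n+1) → ℝ) × ℝ => q.2.1 0) := by fun_prop
    exact (contDiff_const.mul contDiff_fst).mul hp0
  · intro q hq
    simp [hsupp x q.2.1 q.2.2 q.1 (Or.inl hq)]
  · intro q hq
    simp [hsupp x q.2.1 q.2.2 q.1 (Or.inr hq)]
  · intro j
    choose C hC0 hC using aux_amp_bound n m' a ha
    refine ⟨∑ i ∈ Finset.range (j + 1), (j.choose i : ℝ) * (|ℏ⁻¹| * R) ^ i * C (j - i),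
      fun q => ?_⟩
    by_cases hq : R < ‖q.2.1‖
    · have : (fun s => Complex.exp (-Complex.I * Complex.ofReal (ℏ⁻¹ * s * q.2.1 0)) *
          a (s, x, x, q.2.1) q.2.2) = fun _ => 0 := by
        ext s
        simp [hsupp x q.2.1 q.2.2 s (Or.inr hq)]
      simp only [this]
      have hz : iteratedDeriv j (fun _ : ℝ => (0 : ℂ)) q.1 = 0 := by simp
      rw [hz, norm_zero]
      have := hC0
      refine mul_nonneg (Finset.sum_nonneg fun i _ => ?_) (by positivity)
      have := hC0 (j - i)
      positivity
    · push Not at hq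
      have hp : |q.2.1 0| ≤ R := (norm_le_pi_norm q.2.1 0).trans hq
      set c : ℂ := -Complex.I * Complex.ofReal (ℏ⁻¹ * q.2.1 0) with hc
      have hcn : ‖c‖ ≤ |ℏ⁻¹| * R := by
        rw [hc, norm_mul, norm_neg, Complex.norm_I, one_mul, Complex.norm_real, Real.norm_eq_abs,
          abs_mul]
        gcongr
      have e1 : (fun s => Complex.exp (-Complex.I * Complex.ofReal (ℏ⁻¹ * s * q.2.1 0)) *
          a (s, x, x, q.2.1) q.2.2) =
          (fun s : ℝ => Complex.exp (c * s)) * (fun s => a (s, x, x, q.2.1) q.2.2) := by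
        ext s
        simp only [Pi.mul_apply]
        congr 2
        rw [hc]
        push_cast
        ring
      have hs1 : ContDiff ℝ (⊤ : ℕ∞) (fun s : ℝ => Complex.exp (c * s)) :=
        Complex.contDiff_exp.comp (contDiff_const.mul Complex.ofRealCLM.contDiff)
      have hs2 : ContDiff ℝ (⊤ : ℕ∞) (fun s => a (s, x, x, q.2.1) q.2.2) :=
        hsm.comp (f := fun s : ℝ => (s, q.2)) (contDiff_id.prodMk contDiff_const)
      simp only [e1]
      rw [iteratedDeriv_mul (hs1.contDiffAt.of_le (by exact_mod_cast le_top))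
        (hs2.contDiffAt.of_le (by exact_mod_cast le_top)), Finset.sum_mul]
      refine (norm_sum_le _ _).trans (Finset.sum_le_sum fun i _ => ?_)
      rw [aux_exp_iter, norm_mul, norm_mul, norm_mul, norm_pow, Complex.norm_natCast]
      have he : ‖Complex.exp (c * q.1)‖ = 1 := by
        rw [Complex.norm_exp]
        simp [hc]
      rw [he, mul_one, mul_assoc (_ * _)]
      gcongr
      exact hC _ _ _ _ _

lemma aux_F_bound (n : ℕ) (m' R : ℝ) (hR : 0 < R)
    (a : (ℝ × (Fin (n+1) → ℝ) × (Fin (n+1) → ℝ) × (Fin (n+1) → ℝ)) → ℝ → ℂ)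
    (ha : IsAmplitude n m' a)
    (hsupp : ∀ x p σ s, (R < |s| ∨ R < ‖p‖) → a (s, x, x, p) σ = 0) (L : ℕ) :
    ∃ C : ℝ, 0 ≤ C ∧ ∀ x p σ t, (1 + |t|) ^ L *
      ‖∫ s : ℝ, Complex.exp (Complex.I * ((s * t : ℝ) : ℂ)) * a (s, x, x, p) σ‖
        ≤ C * (1 + |σ|) ^ m' := by
  have key : ∀ j : ℕ, ∃ C : ℝ, 0 ≤ C ∧ ∀ x p σ t, |t| ^ j *
      ‖∫ s : ℝ, Complex.exp (Complex.I * ((s * t : ℝ) : ℂ)) * a (s, x, x, p) σ‖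
        ≤ C * (1 + |σ|) ^ m' := by
    intro j
    obtain ⟨C, hC0, hC⟩ := aux_amp_bound n m' a ha j
    refine ⟨C * (2 * R), by positivity, fun x p σ t => ?_⟩
    have hsm : ContDiff ℝ (⊤ : ℕ∞) (fun s => a (s, x, x, p) σ) :=
      (aux_slice_smooth n m' a ha x).comp (f := fun s : ℝ => (s, p, σ))
        (contDiff_id.prodMk contDiff_const)
    have hcs : HasCompactSupport (fun s => a (s, x, x, p) σ) := by
      refine HasCompactSupport.intro (isCompact_Icc (a := -R) (b := R)) fun s hs => ?_
      refine hsupp _ _ _ _ (Or.inl ?_)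
      by_contra h
      push Not at h
      exact hs (abs_le.1 h)
    have h := aux_ibp_iter j _ hsm hcs t
    have h' := congrArg norm h
    rw [norm_mul, norm_pow, norm_neg, norm_mul, Complex.norm_I, one_mul, Complex.norm_real,
      Real.norm_eq_abs] at h'
    rw [← h']
    have hset : ∫ s : ℝ, Complex.exp (Complex.I * ((s * t : ℝ) : ℂ)) *
        iteratedDeriv j (fun s => a (s, x, x, p) σ) s =
        ∫ s in Set.Icc (-R) R, Complex.exp (Complex.I * ((s * t : ℝ) : ℂ)) *
        iteratedDeriv j (fun s => a (s, x, x, p) σ) s := by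
      symm
      refine setIntegral_eq_integral_of_forall_compl_eq_zero fun s hs => ?_
      rw [aux_iter_zero R _ (fun s hs => hsupp x p σ s (Or.inl hs)) j s, mul_zero]
      by_contra h
      push Not at h
      exact hs (abs_le.1 h)
    rw [hset]
    refine (norm_setIntegral_le_of_norm_le_const (C := C * (1 + |σ|) ^ m') (by simp)
      fun s _ => ?_).trans ?_
    · rw [norm_mul, Complex.norm_exp]
      simpa using hC x p σ s
    · simp only [Real.volume_real_Icc]
      rw [max_eq_left (by linarith)]
      apply le_of_eq
      ring
  obtain ⟨C0, hC00, hC0⟩ := key 0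
  obtain ⟨C1, hC10, hC1⟩ := key L
  refine ⟨2 ^ (L - 1) * (C0 + C1), by positivity, fun x p σ t => ?_⟩
  have h := add_pow_le (zero_le_one) (abs_nonneg t) L
  rw [one_pow] at h
  have h0 := hC0 x p σ t
  have h1 := hC1 x p σ t
  rw [pow_zero, one_mul] at h0
  calc _ ≤ (2 ^ (L - 1) * (1 + |t| ^ L)) *
      ‖∫ s : ℝ, Complex.exp (Complex.I * ((s * t : ℝ) : ℂ)) * a (s, x, x, p) σ‖ := by gcongr
    _ = 2 ^ (L - 1) * (‖∫ s : ℝ, Complex.exp (Complex.I * ((s * t : ℝ) : ℂ)) * a (s, x, x, p) σ‖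
       + |t| ^ L * ‖∫ s : ℝ, Complex.exp (Complex.I * ((s * t : ℝ) : ℂ)) * a (s, x, x, p) σ‖) := by
      ring
    _ ≤ 2 ^ (L - 1) * (C0 * (1 + |σ|) ^ m' + C1 * (1 + |σ|) ^ m') := by gcongr
    _ = _ := by ring

lemma aux_weight (m' σ : ℝ) :
    (1 + |σ|) ^ m' * ((1 + σ ^ 2)⁻¹) ^ (⌈m' / 2 + 1⌉₊) ≤
      2 ^ (⌈m' / 2 + 1⌉₊) * (1 + σ ^ 2)⁻¹ := by
  set K := ⌈m' / 2 + 1⌉₊ with hK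
  have hKm : m' / 2 + 1 ≤ K := Nat.le_ceil _
  have h1 : (1 : ℝ) ≤ 1 + |σ| := by linarith [abs_nonneg σ]
  have hsq : (1 + |σ|) ^ 2 ≤ 2 * (1 + σ ^ 2) := by
    nlinarith [sq_nonneg (|σ| - 1), sq_abs σ]
  have hge : 1 + σ ^ 2 ≤ (1 + |σ|) ^ 2 := by
    nlinarith [abs_nonneg σ, sq_abs σ]
  have hpos : 0 < 1 + σ ^ 2 := by positivity
  have h2 : (1 + |σ|) ^ m' * (1 + |σ|) ^ 2 ≤ ((1 + |σ|) ^ 2) ^ K := by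
    rw [← pow_mul, ← Real.rpow_natCast, ← Real.rpow_natCast, ← Real.rpow_add (by linarith)]
    apply Real.rpow_le_rpow_of_exponent_le h1
    push_cast
    linarith
  have h3 : (1 + |σ|) ^ m' * (1 + σ ^ 2) ≤ 2 ^ K * (1 + σ ^ 2) ^ K := by
    calc _ ≤ (1 + |σ|) ^ m' * (1 + |σ|) ^ 2 := by gcongr
      _ ≤ ((1 + |σ|) ^ 2) ^ K := h2
      _ ≤ (2 * (1 + σ ^ 2)) ^ K := by gcongr
      _ = _ := mul_pow _ _ _
  rw [inv_pow, ← div_eq_mul_inv, ← div_eq_mul_inv, div_le_div_iff₀ (by positivity) hpos]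
  exact h3

lemma aux_osc_integrable (n : ℕ) (m' R : ℝ) (hR : 0 < R)
    (a : (ℝ × (Fin (n+1) → ℝ) × (Fin (n+1) → ℝ) × (Fin (n+1) → ℝ)) → ℝ → ℂ)
    (ha : IsAmplitude n m' a)
    (hsupp : ∀ x p σ s, (R < |s| ∨ R < ‖p‖) → a (s, x, x, p) σ = 0)
    (ℏ : ℝ) (x : Fin (n+1) → ℝ) :
    Integrable (oscIntegrand n a ℏ x x (⌈m' / 2 + 1⌉₊)) := by
  obtain ⟨g1, g2, g3, g4⟩ := aux_good_T_iter n m' R _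
    (aux_good_exp n m' R hR a ha hsupp ℏ x) (⌈m' / 2 + 1⌉₊)
  set K := ⌈m' / 2 + 1⌉₊ with hK
  obtain ⟨C, hC⟩ := g4 0
  have hdom : Integrable (fun q : ℝ × (Fin (n+1) → ℝ) × ℝ => (|C| * 2 ^ K) *
      ((Set.Icc (-R) R).indicator (fun _ => (1 : ℝ)) q.1 *
        ((Metric.closedBall (0 : Fin (n+1) → ℝ) R).indicator (fun _ => (1 : ℝ)) q.2.1 *
          (1 + q.2.2 ^ 2)⁻¹))) := by
    refine Integrable.const_mul ?_ _
    refine Integrable.mul_prod (f := (Set.Icc (-R) R).indicator (fun _ => (1 : ℝ)))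
      (g := fun q : (Fin (n+1) → ℝ) × ℝ =>
        (Metric.closedBall (0 : Fin (n+1) → ℝ) R).indicator (fun _ => (1 : ℝ)) q.1 *
          (1 + q.2 ^ 2)⁻¹) ?_ ?_
    · exact (integrable_indicator_iff measurableSet_Icc).2 (integrableOn_const (by simp))
    · refine Integrable.mul_prod (f := (Metric.closedBall (0 : Fin (n+1) → ℝ) R).indicator
        (fun _ => (1 : ℝ))) (g := fun σ : ℝ => (1 + σ ^ 2)⁻¹) ?_ integrable_inv_one_add_sq
      exact (integrable_indicator_iff measurableSet_closedBall).2
        (integrableOn_const measure_closedBall_lt_top.ne)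
  refine hdom.mono' ?_ (Filter.Eventually.of_forall fun q => ?_)
  · refine Continuous.aestronglyMeasurable ?_
    refine Continuous.mul (Continuous.mul ?_ ?_) g1.continuous
    · fun_prop
    · refine Continuous.pow (Continuous.inv₀ (by fun_prop) fun q => ?_) _
      have : (1 + q.2.2 ^ 2 : ℝ) ≠ 0 := by positivity
      exact_mod_cast this
  · have hn : ‖oscIntegrand n a ℏ x x K q‖ = ((1 + q.2.2 ^ 2)⁻¹) ^ K *
        ‖(oneAddDsq^[K]
        (fun s => Complex.exp (-Complex.I * Complex.ofReal (ℏ⁻¹ * s * q.2.1 0)) *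
          a (s, x, x, q.2.1) q.2.2)) q.1‖ := by
      unfold oscIntegrand
      rw [norm_mul, norm_mul, norm_pow, norm_inv, Complex.norm_real, Complex.norm_exp,
        Real.norm_of_nonneg (show (0 : ℝ) ≤ 1 + q.2.2 ^ 2 by positivity)]
      simp
    rw [hn]
    dsimp only at g2 g3
    by_cases h1 : R < |q.1|
    · rw [g2 q h1, norm_zero, mul_zero]
      refine mul_nonneg (by positivity) (mul_nonneg (Set.indicator_nonneg (by simp) _)
        (mul_nonneg (Set.indicator_nonneg (by simp) _) (by positivity)))
    by_cases h2 : R < ‖q.2.1‖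
    · rw [g3 q h2, norm_zero, mul_zero]
      refine mul_nonneg (by positivity) (mul_nonneg (Set.indicator_nonneg (by simp) _)
        (mul_nonneg (Set.indicator_nonneg (by simp) _) (by positivity)))
    push Not at h1 h2
    rw [Set.indicator_of_mem (show q.1 ∈ Set.Icc (-R) R from abs_le.1 h1),
      Set.indicator_of_mem (by simpa using h2), one_mul, one_mul]
    have hb := hC q
    simp only [iteratedDeriv_zero] at hb
    calc _ ≤ ((1 + q.2.2 ^ 2)⁻¹) ^ K * (C * (1 + |q.2.2|) ^ m') := by gcongr
      _ ≤ ((1 + q.2.2 ^ 2)⁻¹) ^ K * (|C| * (1 + |q.2.2|) ^ m') := by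
        gcongr
        exact le_abs_self C
      _ = |C| * ((1 + |q.2.2|) ^ m' * ((1 + q.2.2 ^ 2)⁻¹) ^ K) := by ring
      _ ≤ |C| * (2 ^ K * (1 + q.2.2 ^ 2)⁻¹) := by
        gcongr ?_ * ?_
        exact aux_weight m' q.2.2
      _ = _ := by ring

lemma aux_cutoff_integrable (n : ℕ) (m' R : ℝ)
    (a : (ℝ × (Fin (n+1) → ℝ) × (Fin (n+1) → ℝ) × (Fin (n+1) → ℝ)) → ℝ → ℂ)
    (ha : IsAmplitude n m' a)
    (hsupp : ∀ x p σ s, (R < |s| ∨ R < ‖p‖) → a (s, x, x, p) σ = 0)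
    (μ₀ : ℝ) (ρ : ℝ → ℝ) (hρ : Continuous ρ)
    (hρsupp : Function.support ρ ⊆ Set.Icc (-μ₀) μ₀)
    (ℏ : ℝ) (hℏ : 0 < ℏ) (x : Fin (n+1) → ℝ) :
    Integrable (cutoffIntegrand n a ρ ℏ x) := by
  have hsm := (aux_slice_smooth n m' a ha x).continuous
  refine Continuous.integrable_of_hasCompactSupport ?_ ?_
  · unfold cutoffIntegrand
    refine Continuous.mul (Continuous.mul (by fun_prop) hsm) (by fun_prop)
  · refine HasCompactSupport.intro (K := Set.Icc (-R) R ×ˢ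
      (Metric.closedBall (0 : Fin (n+1) → ℝ) R ×ˢ Set.Icc (-(μ₀ / ℏ)) (μ₀ / ℏ)))
      (isCompact_Icc.prod ((isCompact_closedBall _ _).prod isCompact_Icc)) fun q hq => ?_
    unfold cutoffIntegrand
    by_cases h1 : R < |q.1| ∨ R < ‖q.2.1‖
    · simp [hsupp x q.2.1 q.2.2 q.1 h1]
    push Not at h1
    have : ρ (ℏ * q.2.2) = 0 := by
      by_contra h
      have hm := hρsupp (Function.mem_support.2 h)
      refine hq ⟨abs_le.1 h1.1, by simpa using h1.2, ?_, ?_⟩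
      · rw [neg_le, ← neg_le_neg_iff, neg_neg, ← neg_div, div_le_iff₀ hℏ]
        linarith [hm.1]
      · rw [le_div_iff₀ hℏ]
        linarith [hm.2]
    simp [this]

lemma aux_inner_osc (n : ℕ) (m' R : ℝ)
    (a : (ℝ × (Fin (n+1) → ℝ) × (Fin (n+1) → ℝ) × (Fin (n+1) → ℝ)) → ℝ → ℂ)
    (ha : IsAmplitude n m' a)
    (hsupp : ∀ x p σ s, (R < |s| ∨ R < ‖p‖) → a (s, x, x, p) σ = 0)
    (ℏ : ℝ) (x p : Fin (n+1) → ℝ) (σ : ℝ) (K : ℕ) :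
    ∫ s : ℝ, oscIntegrand n a ℏ x x K (s, p, σ) =
      ∫ s : ℝ, Complex.exp (Complex.I * ((s * (σ - ℏ⁻¹ * p 0) : ℝ) : ℂ)) * a (s, x, x, p) σ := by
  have hsm : ContDiff ℝ (⊤ : ℕ∞) (fun s => a (s, x, x, p) σ) :=
    (aux_slice_smooth n m' a ha x).comp (f := fun s : ℝ => (s, p, σ))
      (contDiff_id.prodMk contDiff_const)
  have hcs : HasCompactSupport (fun s => a (s, x, x, p) σ) := by
    refine HasCompactSupport.intro (isCompact_Icc (a := -R) (b := R)) fun s hs => ?_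
    refine hsupp _ _ _ _ (Or.inl ?_)
    by_contra h
    push Not at h
    exact hs (abs_le.1 h)
  have hs1 : ContDiff ℝ (⊤ : ℕ∞)
      (fun s : ℝ => Complex.exp (-Complex.I * Complex.ofReal (ℏ⁻¹ * s * p 0))) :=
    Complex.contDiff_exp.comp (contDiff_const.mul (Complex.ofRealCLM.contDiff.comp
      ((contDiff_const.mul contDiff_id).mul contDiff_const)))
  have h := aux_ibp_K K _ (hs1.mul hsm) hcs.mul_left σ
  have e1 : ∀ s : ℝ, oscIntegrand n a ℏ x x K (s, p, σ) =
      ((Complex.ofReal (1 + σ ^ 2))⁻¹ ^ K) * (Complex.exp (Complex.I * ((s * σ : ℝ) : ℂ)) *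
        (oneAddDsq^[K] (fun s => Complex.exp (-Complex.I * Complex.ofReal (ℏ⁻¹ * s * p 0)) *
          a (s, x, x, p) σ)) s) := by
    intro s
    simp only [oscIntegrand, sub_self, zero_mul, Finset.sum_const_zero, mul_zero, zero_add]
    ring
  simp_rw [e1]
  rw [integral_const_mul]
  refine (congrArg _ h).trans ?_
  have hne : (Complex.ofReal (1 + σ ^ 2)) ≠ 0 := by
    have : (1 + σ ^ 2 : ℝ) ≠ 0 := by positivity
    exact_mod_cast this
  rw [← mul_assoc, ← mul_pow, inv_mul_cancel₀ hne, one_pow, one_mul]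
  congr 1
  ext s
  rw [← mul_assoc, ← Complex.exp_add]
  congr 2
  push_cast
  ring

lemma aux_inner_cutoff (n : ℕ)
    (a : (ℝ × (Fin (n+1) → ℝ) × (Fin (n+1) → ℝ) × (Fin (n+1) → ℝ)) → ℝ → ℂ)
    (ρ : ℝ → ℝ) (ℏ : ℝ) (x p : Fin (n+1) → ℝ) (σ : ℝ) :
    ∫ s : ℝ, cutoffIntegrand n a ρ ℏ x (s, p, σ) =
      (∫ s : ℝ, Complex.exp (Complex.I * ((s * (σ - ℏ⁻¹ * p 0) : ℝ) : ℂ)) * a (s, x, x, p) σ) *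
        Complex.ofReal (ρ (ℏ * σ)) := by
  rw [← integral_mul_const]
  congr 1
  ext s
  simp only [cutoffIntegrand]
  congr 4
  push_cast
  ring

lemma aux_H (n : ℕ) (m' R : ℝ) (hR : 0 < R)
    (a : (ℝ × (Fin (n+1) → ℝ) × (Fin (n+1) → ℝ) × (Fin (n+1) → ℝ)) → ℝ → ℂ)
    (ha : IsAmplitude n m' a)
    (hsupp : ∀ x p σ s, (R < |s| ∨ R < ‖p‖) → a (s, x, x, p) σ = 0)
    (μ₀ : ℝ) (hμ₀ : 0 < μ₀)
    (hvanish : ∀ s x y p σ, μ₀ / 2 < |p 0| → a (s, x, y, p) σ = 0)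
    (ρ : ℝ → ℝ) (hρsmooth : ContDiff ℝ (⊤ : ℕ∞) ρ) (hρcpt : HasCompactSupport ρ)
    (hρone : ∀ t ∈ Set.Icc (-(μ₀ / 2)) (μ₀ / 2), ρ t = 1) (M : ℕ) :
    ∃ C : ℝ, 0 ≤ C ∧ ∀ ℏ : ℝ, 0 < ℏ → ℏ ≤ 1 → ∀ (x p : Fin (n+1) → ℝ) (σ : ℝ),
      ‖(∫ s : ℝ, Complex.exp (Complex.I * ((s * (σ - ℏ⁻¹ * p 0) : ℝ) : ℂ)) * a (s, x, x, p) σ) *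
        (1 - Complex.ofReal (ρ (ℏ * σ)))‖ ≤
        C * (ℏ ^ M * ℏ⁻¹ ^ ⌈m'⌉₊) * (1 + (σ - ℏ⁻¹ * p 0) ^ 2)⁻¹ := by
  set k := ⌈m'⌉₊ with hk
  obtain ⟨C1, hC10, hC1⟩ := aux_F_bound n m' R hR a ha hsupp (M + k + 2)
  obtain ⟨C2, hC20, hC2⟩ := aux_flat (μ₀ / 2) (by positivity) M (fun t => 1 - ρ t)
    (contDiff_const.sub hρsmooth) (by
      intro j
      have hcj : Continuous (iteratedDeriv j ρ) :=
        hρsmooth.continuous_iteratedDeriv j (by exact_mod_cast le_top)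
      have hsj : HasCompactSupport (iteratedDeriv j ρ) := by
        have := hρcpt.iteratedFDeriv (𝕜 := ℝ) j
        refine this.mono' ?_
        refine subset_trans (fun t ht => ?_) subset_closure
        rw [Function.mem_support] at ht ⊢
        intro h0
        apply ht
        rw [← norm_eq_zero, ← norm_iteratedFDeriv_eq_norm_iteratedDeriv, h0, norm_zero]
      obtain ⟨B, hB⟩ := hsj.exists_bound_of_continuous hcj
      refine ⟨1 + B, fun t => ?_⟩
      rw [iteratedDeriv_fun_sub contDiffAt_const
        (hρsmooth.contDiffAt.of_le (by exact_mod_cast le_top))]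
      refine (abs_sub _ _).trans (add_le_add ?_ (hB t))
      rw [iteratedDeriv_const]
      split_ifs <;> simp) (fun t ht => by rw [hρone t ht, sub_self])
  refine ⟨C1 * C2 * (1 + μ₀) ^ k, by positivity, fun ℏ hℏ hℏ1 x p σ => ?_⟩
  set t := σ - ℏ⁻¹ * p 0 with ht
  by_cases hp : μ₀ / 2 < |p 0|
  · have : ∀ s, a (s, x, x, p) σ = 0 := fun s => hvanish s x x p σ hp
    simp only [this, mul_zero, integral_zero, zero_mul, norm_zero]
    positivity
  push Not at hp
  set F := ∫ s : ℝ, Complex.exp (Complex.I * ((s * t : ℝ) : ℂ)) * a (s, x, x, p) σ with hF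
  have hF1 := hC1 x p σ t
  rw [← hF] at hF1
  have hr : ‖1 - Complex.ofReal (ρ (ℏ * σ))‖ ≤ C2 * (ℏ ^ M * |t| ^ M) := by
    have h := hC2 (ℏ * σ) (p 0) (abs_le.1 hp)
    have e : ℏ * σ - p 0 = ℏ * t := by
      rw [ht]
      field_simp
    rw [e, abs_mul, abs_of_pos hℏ, mul_pow] at h
    have e2 : 1 - Complex.ofReal (ρ (ℏ * σ)) = Complex.ofReal (1 - ρ (ℏ * σ)) := by
      push_cast
      ring
    rw [e2, Complex.norm_real]
    exact h
  have hinv : 1 ≤ ℏ⁻¹ := (one_le_inv₀ hℏ).2 hℏ1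
  have hσ : 1 + |σ| ≤ (1 + μ₀) * ℏ⁻¹ * (1 + |t|) := by
    have e : σ = t + ℏ⁻¹ * p 0 := by rw [ht]; ring
    have h1 : |σ| ≤ |t| + ℏ⁻¹ * (μ₀ / 2) := by
      calc |σ| = |t + ℏ⁻¹ * p 0| := by rw [← e]
        _ ≤ |t| + |ℏ⁻¹ * p 0| := abs_add_le _ _
        _ = |t| + ℏ⁻¹ * |p 0| := by rw [abs_mul, abs_of_pos (by positivity : 0 < ℏ⁻¹)]
        _ ≤ _ := by gcongr
    have h2 : 0 ≤ (ℏ⁻¹ - 1) * |t| := mul_nonneg (by linarith) (abs_nonneg _)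
    have h3 : 0 ≤ μ₀ * ℏ⁻¹ * |t| := by positivity
    have h4 : 0 ≤ μ₀ * ℏ⁻¹ := by positivity
    nlinarith
  have hw : (1 + |σ|) ^ m' ≤ ((1 + μ₀) * ℏ⁻¹ * (1 + |t|)) ^ k := by
    calc (1 + |σ|) ^ m' ≤ (1 + |σ|) ^ (k : ℝ) :=
          Real.rpow_le_rpow_of_exponent_le (by linarith [abs_nonneg σ]) (Nat.le_ceil _)
      _ = (1 + |σ|) ^ k := Real.rpow_natCast _ _
      _ ≤ _ := by gcongr
  have hmain : (1 + |t|) ^ (M + k) * ((1 + |t|) ^ 2 * ‖F * (1 - Complex.ofReal (ρ (ℏ * σ)))‖) ≤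
      (1 + |t|) ^ (M + k) * (C1 * C2 * (1 + μ₀) ^ k * (ℏ ^ M * ℏ⁻¹ ^ k)) := by
    calc _ = ((1 + |t|) ^ (M + k + 2) * ‖F‖) * ‖1 - Complex.ofReal (ρ (ℏ * σ))‖ := by
          rw [norm_mul]; ring
      _ ≤ (C1 * ((1 + μ₀) * ℏ⁻¹ * (1 + |t|)) ^ k) * (C2 * (ℏ ^ M * (1 + |t|) ^ M)) := by
        refine mul_le_mul (hF1.trans (by gcongr)) (hr.trans ?_) (norm_nonneg _) (by positivity)
        gcongr
        linarith
      _ = _ := by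
        rw [mul_pow, mul_pow]; ring
  have h2 := le_of_mul_le_mul_left hmain (by positivity)
  have h3 : 1 + t ^ 2 ≤ (1 + |t|) ^ 2 := by
    nlinarith [abs_nonneg t, sq_abs t]
  rw [← div_eq_mul_inv, le_div_iff₀ (by positivity)]
  calc _ ≤ ‖F * (1 - Complex.ofReal (ρ (ℏ * σ)))‖ * (1 + |t|) ^ 2 := by gcongr
    _ ≤ _ := by rw [mul_comm]; exact h2

/-- inserting the spectral cutoff `ρ(ℏσ)` changes `u_ℏ(x,x)` only by
`O(ℏ^∞)`, uniformly in `x`. -/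
theorem statement2 (n : ℕ) (m' : ℝ)
    (a : (ℝ × (Fin (n+1) → ℝ) × (Fin (n+1) → ℝ) × (Fin (n+1) → ℝ)) → ℝ → ℂ)
    (ha : IsAmplitude n m' a)
    (μ₀ : ℝ) (hμ₀ : 0 < μ₀)
    (hvanish : ∀ s x y p σ, μ₀ / 2 < |p 0| → a (s, x, y, p) σ = 0)
    (ρ : ℝ → ℝ) (hρsmooth : ContDiff ℝ (⊤ : ℕ∞) ρ) (hρcpt : HasCompactSupport ρ)
    (hρone : ∀ t ∈ Set.Icc (-(μ₀ / 2)) (μ₀ / 2), ρ t = 1)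
    (hρsupp : Function.support ρ ⊆ Set.Icc (-μ₀) μ₀) :
    ∀ N : ℕ, ∃ C : ℝ, ∀ ℏ : ℝ, 0 < ℏ → ℏ ≤ 1 → ∀ x : Fin (n+1) → ℝ,
      Integrable (cutoffIntegrand n a ρ ℏ x) ∧
      ‖uh n m' a ℏ x x -
          Complex.ofReal ((2 * π * ℏ) ^ (-((n : ℤ) + 1))) *
            ∫ q, cutoffIntegrand n a ρ ℏ x q‖ ≤ C * ℏ ^ N := by
  intro N
  obtain ⟨R, hR, hsupp⟩ := aux_amp_supp n m' a ha
  obtain ⟨C, hC0, hC⟩ := aux_H n m' R hR a ha hsupp μ₀ hμ₀ hvanish ρ hρsmooth hρcpt hρone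
    (N + ⌈m'⌉₊ + (n + 1))
  set k := ⌈m'⌉₊ with hk
  set V := (volume : Measure (Fin (n+1) → ℝ)).real (Metric.closedBall 0 R) with hV
  refine ⟨((2 * π) ^ (n + 1))⁻¹ * (C * π * V), fun ℏ hℏ hℏ1 x => ?_⟩
  have hic := aux_cutoff_integrable n m' R a ha hsupp μ₀ ρ hρsmooth.continuous hρsupp ℏ hℏ x
  have hio := aux_osc_integrable n m' R hR a ha hsupp ℏ x
  refine ⟨hic, ?_⟩
  set F : (Fin (n+1) → ℝ) × ℝ → ℂ := fun z => (∫ s : ℝ, Complex.exp (Complex.I *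
    ((s * (z.2 - ℏ⁻¹ * z.1 0) : ℝ) : ℂ)) * a (s, x, x, z.1) z.2) *
        (1 - Complex.ofReal (ρ (ℏ * z.2))) with hF
  have ho2 : Integrable (fun z : (Fin (n+1) → ℝ) × ℝ =>
      ∫ s : ℝ, oscIntegrand n a ℏ x x (⌈m' / 2 + 1⌉₊) (s, z)) := hio.integral_prod_right
  have hc2 : Integrable (fun z : (Fin (n+1) → ℝ) × ℝ =>
      ∫ s : ℝ, cutoffIntegrand n a ρ ℏ x (s, z)) := hic.integral_prod_right
  have hFe : ∀ z : (Fin (n+1) → ℝ) × ℝ, (∫ s : ℝ, oscIntegrand n a ℏ x x (⌈m' / 2 + 1⌉₊) (s, z)) -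
      (∫ s : ℝ, cutoffIntegrand n a ρ ℏ x (s, z)) = F z := by
    intro z
    have h1 := aux_inner_osc n m' R a ha hsupp ℏ x z.1 z.2 (⌈m' / 2 + 1⌉₊)
    have h2 := aux_inner_cutoff n a ρ ℏ x z.1 z.2
    rw [hF]
    simp only [Prod.mk.eta] at h1 h2
    rw [h1, h2]
    ring
  have hFi : Integrable F := by
    have := ho2.sub hc2
    refine this.congr (Filter.Eventually.of_forall fun z => ?_)
    exact hFe z
  have hdiff : (∫ q, oscIntegrand n a ℏ x x (⌈m' / 2 + 1⌉₊) q) -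
      (∫ q, cutoffIntegrand n a ρ ℏ x q) = ∫ p, ∫ σ, F (p, σ) := by
    have e1 : (∫ q, oscIntegrand n a ℏ x x (⌈m' / 2 + 1⌉₊) q) =
        ∫ z : (Fin (n+1) → ℝ) × ℝ, ∫ s : ℝ, oscIntegrand n a ℏ x x (⌈m' / 2 + 1⌉₊) (s, z) :=
      integral_prod_symm _ hio
    have e2 : (∫ q, cutoffIntegrand n a ρ ℏ x q) =
        ∫ z : (Fin (n+1) → ℝ) × ℝ, ∫ s : ℝ, cutoffIntegrand n a ρ ℏ x (s, z) :=
      integral_prod_symm _ hic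
    have e3 : ∫ z, F z = ∫ p, ∫ σ, F (p, σ) := integral_prod _ hFi
    rw [e1, e2, ← integral_sub ho2 hc2, ← e3]
    exact integral_congr_ae (Filter.Eventually.of_forall hFe)
  set M := N + k + (n + 1) with hM
  have hin : ∀ p : Fin (n+1) → ℝ, ‖∫ σ, F (p, σ)‖ ≤ C * (ℏ ^ M * ℏ⁻¹ ^ k) * π := by
    intro p
    have hint : Integrable (fun σ : ℝ => C * (ℏ ^ M * ℏ⁻¹ ^ k) *
        (1 + (σ - ℏ⁻¹ * p 0) ^ 2)⁻¹) :=
      (integrable_inv_one_add_sq.comp_sub_right (ℏ⁻¹ * p 0)).const_mul _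
    refine (norm_integral_le_of_norm_le hint (Filter.Eventually.of_forall fun σ =>
      hC ℏ hℏ hℏ1 x p σ)).trans ?_
    rw [integral_const_mul,
      integral_sub_right_eq_self (fun σ : ℝ => (1 + σ ^ 2)⁻¹) (ℏ⁻¹ * p 0),
      integral_univ_inv_one_add_sq]
  have hout : ‖∫ p, ∫ σ, F (p, σ)‖ ≤ C * (ℏ ^ M * ℏ⁻¹ ^ k) * π * V := by
    have e : ∫ p, ∫ σ, F (p, σ) = ∫ p in Metric.closedBall 0 R, ∫ σ, F (p, σ) := by
      symm
      refine setIntegral_eq_integral_of_forall_compl_eq_zero fun p hp => ?_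
      have hp' : R < ‖p‖ := by simpa using hp
      have : ∀ σ, F (p, σ) = 0 := by
        intro σ
        simp [hF, hsupp x p σ _ (Or.inr hp')]
      simp [this]
    rw [e]
    exact norm_setIntegral_le_of_norm_le_const measure_closedBall_lt_top fun p _ => hin p
  unfold uh
  rw [← mul_sub, hdiff, norm_mul, Complex.norm_real]
  have hz : (2 * π * ℏ) ^ (-((n : ℤ) + 1)) = ((2 * π) ^ (n + 1))⁻¹ * ℏ⁻¹ ^ (n + 1) := by
    rw [zpow_neg, show ((n : ℤ) + 1) = ((n + 1 : ℕ) : ℤ) by push_cast; ring, zpow_natCast,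
      mul_pow, mul_inv, inv_pow]
  rw [hz, Real.norm_of_nonneg (by positivity)]
  calc _ ≤ ((2 * π) ^ (n + 1))⁻¹ * ℏ⁻¹ ^ (n + 1) * (C * (ℏ ^ M * ℏ⁻¹ ^ k) * π * V) := by gcongr
    _ = ((2 * π) ^ (n + 1))⁻¹ * (C * π * V) * (ℏ ^ M * ℏ⁻¹ ^ k * ℏ⁻¹ ^ (n + 1)) := by ring
    _ = _ := by
      congr 1
      rw [hM, pow_add, pow_add, inv_pow, inv_pow]
      field_simp
end
end

section
/- Let a be an amplitude of order m′ with m′ ≥ 0. Then, as ħ → 0⁺, ∫_{ℝ^n} u_ħ(x,x) dx = (2πħ)^{−n} · 2π · ∫_{ℝ^n × ℝ^{n−1} × ℝ} a(0, x, x, (μ,p′), ħ^{−1}μ) dx dp′ dμ + O(ħ^{−n−m′+1}); that is, there are constants C > 0 and ħ₀ > 0 such that for all 0 < ħ ≤ ħ₀ the absolute value of the difference of the two sides is at most C ħ^{−n−m′+1}. (Here (μ,p′) denotes the momentum variable p with first component p₁ = μ, and the argument σ of a is set equal to ħ^{−1}μ.) -/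
open MeasureTheory Real

noncomputable section

open scoped ContDiff

namespace TraceAux

/-- bounded derivatives up to order `L`. -/
def DB (L : ℕ) (A : ℝ) (f : ℝ → ℂ) : Prop :=
  ∀ j ≤ L, ∀ s, ‖iteratedDeriv j f s‖ ≤ A

lemma contDiff_deriv {f : ℝ → ℂ} (hf : ContDiff ℝ ∞ f) : ContDiff ℝ ∞ (deriv f) :=
  ((contDiff_infty_iff_deriv (𝕜 := ℝ)).1 hf).2

lemma contDiff_oneAddDsq {f : ℝ → ℂ} (hf : ContDiff ℝ ∞ f) : ContDiff ℝ ∞ (oneAddDsq f) :=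
  hf.sub (contDiff_deriv (contDiff_deriv hf))

lemma tsupport_oneAddDsq (f : ℝ → ℂ) : tsupport (oneAddDsq f) ⊆ tsupport f := by
  have h2 : tsupport (deriv (deriv f)) ⊆ tsupport f :=
    (tsupport_deriv_subset (𝕜 := ℝ) (f := deriv f)).trans
      (tsupport_deriv_subset (𝕜 := ℝ) (f := f))
  have h := tsupport_sub f (deriv (deriv f))
  exact h.trans (Set.union_subset le_rfl h2)

lemma tsupport_oneAddDsq_iter (K : ℕ) (f : ℝ → ℂ) : tsupport (oneAddDsq^[K] f) ⊆ tsupport f := by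
  induction K generalizing f with
  | zero => exact le_rfl
  | succ K ih => exact (ih (oneAddDsq f)).trans (tsupport_oneAddDsq f)

lemma contDiff_oneAddDsq_iter (K : ℕ) {f : ℝ → ℂ} (hf : ContDiff ℝ ∞ f) :
    ContDiff ℝ ∞ (oneAddDsq^[K] f) := by
  induction K generalizing f with
  | zero => exact hf
  | succ K ih => exact ih (contDiff_oneAddDsq hf)

lemma DB_oneAddDsq {L : ℕ} {A : ℝ} {f : ℝ → ℂ} (hf : ContDiff ℝ ∞ f) (h : DB (L + 2) A f) :
    DB L (2 * A) (oneAddDsq f) := by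
  intro j hj s
  have h1 : iteratedDeriv j (oneAddDsq f) s = iteratedDeriv j f s - iteratedDeriv (j + 2) f s := by
    unfold oneAddDsq
    rw [iteratedDeriv_fun_sub, iteratedDeriv_succ', iteratedDeriv_succ']
    · exact (hf.of_le (by exact_mod_cast le_top)).contDiffAt
    · exact ((contDiff_deriv (contDiff_deriv hf)).of_le (by exact_mod_cast le_top)).contDiffAt
  rw [h1]
  have := h j (by omega) s
  have := h (j + 2) (by omega) s
  refine (norm_sub_le _ _).trans (by linarith)

lemma DB_oneAddDsq_iter {L : ℕ} (K : ℕ) {A : ℝ} {f : ℝ → ℂ} (hf : ContDiff ℝ ∞ f)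
    (h : DB (L + 2 * K) A f) :
    DB L (2 ^ K * A) (oneAddDsq^[K] f) := by
  induction K generalizing f A with
  | zero => simpa using h
  | succ K ih =>
    have := ih (contDiff_oneAddDsq hf) (A := 2 * A) (DB_oneAddDsq hf h)
    rw [Function.iterate_succ, Function.comp]
    convert this using 1
    ring

/-- phase factor -/
def ph (t s : ℝ) : ℂ := Complex.exp (Complex.I * Complex.ofReal (s * t))

lemma norm_ph (t s : ℝ) : ‖ph t s‖ = 1 := by
  unfold ph
  rw [mul_comm]; exact Complex.norm_exp_ofReal_mul_I _

lemma hasDerivAt_ph (t s : ℝ) : HasDerivAt (ph t) (Complex.I * t * ph t s) s := by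
  unfold ph
  have h1 : HasDerivAt (fun s : ℝ => Complex.I * Complex.ofReal (s * t)) (Complex.I * t) s := by
    have := ((hasDerivAt_id s).mul_const t).ofReal_comp.const_mul Complex.I
    simpa using this
  simpa [mul_comm] using h1.cexp

lemma contDiff_ph2 : ContDiff ℝ ∞ (fun q : ℝ × ℝ => ph q.1 q.2) := by
  unfold ph
  apply ContDiff.cexp
  apply contDiff_const.mul
  exact Complex.ofRealCLM.contDiff.comp (contDiff_snd.mul contDiff_fst)

lemma contDiff_ph (t : ℝ) : ContDiff ℝ ∞ (ph t) :=
  contDiff_ph2.comp (contDiff_const.prodMk contDiff_id)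

lemma continuous_ph (t : ℝ) : Continuous (ph t) := (contDiff_ph t).continuous

lemma ibp1 {f : ℝ → ℂ} (hf : ContDiff ℝ ∞ f) (hc : HasCompactSupport f) (ξ : ℝ) :
    ∫ s, ph ξ s * deriv f s = - (Complex.I * ξ) * ∫ s, ph ξ s * f s := by
  have hd := contDiff_deriv hf
  have hdc : HasCompactSupport (deriv f) := hc.deriv
  have := integral_mul_deriv_eq_deriv_mul_of_integrable (u := ph ξ) (v := f)
    (u' := fun s => Complex.I * ξ * ph ξ s) (v' := deriv f)
    (fun s _ => hasDerivAt_ph ξ s)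
    (fun s _ => (hf.differentiable (by simp) s).hasDerivAt)
    (((continuous_ph ξ).mul hd.continuous).integrable_of_hasCompactSupport hdc.mul_left)
    (((continuous_const.mul (continuous_ph ξ)).mul hf.continuous).integrable_of_hasCompactSupport
      hc.mul_left)
    (((continuous_ph ξ).mul hf.continuous).integrable_of_hasCompactSupport hc.mul_left)
  rw [this, ← integral_const_mul, ← integral_neg]
  congr 1; ext s; ring

lemma ibp2 {f : ℝ → ℂ} (hf : ContDiff ℝ ∞ f) (hc : HasCompactSupport f) (ξ : ℝ) :
    ∫ s, ph ξ s * oneAddDsq f s = Complex.ofReal (1 + ξ ^ 2) * ∫ s, ph ξ s * f s := by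
  have hd := contDiff_deriv hf
  have hdc : HasCompactSupport (deriv f) := hc.deriv
  have hd2 := contDiff_deriv hd
  have h1 := ibp1 hd hdc ξ
  rw [ibp1 hf hc ξ] at h1
  have h2 : ∫ s, ph ξ s * oneAddDsq f s = (∫ s, ph ξ s * f s) - ∫ s, ph ξ s * deriv (deriv f) s := by
    rw [← integral_sub]
    · congr 1; ext s; unfold oneAddDsq; ring
    · exact ((continuous_ph ξ).mul hf.continuous).integrable_of_hasCompactSupport hc.mul_left
    · exact ((continuous_ph ξ).mul hd2.continuous).integrable_of_hasCompactSupport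
        hdc.deriv.mul_left
  rw [h2, h1]
  push_cast
  linear_combination (-(ξ:ℂ) ^ 2 * ∫ s, ph ξ s * f s) * Complex.I_sq

lemma hasCompactSupport_iter (K : ℕ) {f : ℝ → ℂ} (hc : HasCompactSupport f) :
    HasCompactSupport (oneAddDsq^[K] f) :=
  HasCompactSupport.of_support_subset_isCompact hc
    (subset_closure.trans (tsupport_oneAddDsq_iter K f))

lemma ibpK (K : ℕ) {f : ℝ → ℂ} (hf : ContDiff ℝ ∞ f) (hc : HasCompactSupport f) (ξ : ℝ) :
    ∫ s, ph ξ s * (oneAddDsq^[K] f) s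
      = Complex.ofReal (1 + ξ ^ 2) ^ K * ∫ s, ph ξ s * f s := by
  induction K with
  | zero => simp
  | succ K ih =>
    rw [Function.iterate_succ']
    simp only [Function.comp]
    rw [ibp2 (contDiff_oneAddDsq_iter K hf) (hasCompactSupport_iter K hc), ih]
    ring

lemma iter_eq_zero (K : ℕ) {f : ℝ → ℂ} {R : ℝ} (h : ∀ s, R < |s| → f s = 0) (s : ℝ)
    (hs : R < |s|) : (oneAddDsq^[K] f) s = 0 := by
  have h1 : tsupport f ⊆ Metric.closedBall 0 R := by
    apply closure_minimal _ Metric.isClosed_closedBall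
    intro s hs
    by_contra h'
    apply hs
    apply h
    simpa using h'
  have h2 : s ∉ tsupport (oneAddDsq^[K] f) := by
    intro h3
    have := h1 (tsupport_oneAddDsq_iter K f h3)
    simp at this
    linarith
  exact image_eq_zero_of_notMem_tsupport h2

lemma hasCompactSupport_of {f : ℝ → ℂ} {R : ℝ} (h : ∀ s, R < |s| → f s = 0) :
    HasCompactSupport f := by
  apply HasCompactSupport.intro (isCompact_closedBall (0:ℝ) R)
  intro s hs
  apply h
  simpa using hs

lemma decay (M : ℕ) {f : ℝ → ℂ} (hf : ContDiff ℝ ∞ f) {R A : ℝ} (hR : 0 ≤ R)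
    (h : ∀ s, R < |s| → f s = 0) (hA : DB (2 * M) A f) (ξ : ℝ) :
    ‖∫ s, ph ξ s * f s‖ ≤ 2 ^ M * A * (2 * R) * ((1 + ξ ^ 2)⁻¹) ^ M := by
  have h1 := ibpK M hf (hasCompactSupport_of h) ξ
  have hpos : 0 < 1 + ξ ^ 2 := by positivity
  have h2 : ‖∫ s, ph ξ s * (oneAddDsq^[M] f) s‖ ≤ 2 ^ M * A * (2 * R) := by
    rw [← setIntegral_eq_integral_of_forall_compl_eq_zero (s := Set.Icc (-R) R)]
    · refine (norm_setIntegral_le_of_norm_le_const (C := 2 ^ M * A) (by simp) ?_).trans ?_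
      · intro s _
        rw [norm_mul, norm_ph, one_mul]
        have := DB_oneAddDsq_iter (L := 0) M hf (by simpa using hA) 0 le_rfl s
        simpa using this
      · rw [Real.volume_real_Icc_of_le (by linarith)]
        apply le_of_eq; ring
    · intro s hs
      rw [iter_eq_zero M h s, mul_zero]
      rw [Set.mem_Icc, ← abs_le] at hs
      linarith
  rw [h1, norm_mul, norm_pow, Complex.norm_real, Real.norm_of_nonneg hpos.le] at h2
  rw [inv_pow, ← div_eq_mul_inv, le_div_iff₀ (by positivity)]
  linarith

lemma DB_ph_mul (t : ℝ) (L : ℕ) {A : ℝ} {f : ℝ → ℂ} (hf : ContDiff ℝ ∞ f) (h : DB L A f) :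
    ∀ s, ‖iteratedDeriv L (fun s => ph t s * f s) s‖ ≤ (1 + |t|) ^ L * A := by
  induction L generalizing f A with
  | zero =>
    intro s
    have := h 0 le_rfl s
    simpa [norm_ph] using this
  | succ L ih =>
    intro s
    have hd : deriv (fun s => ph t s * f s) = fun s => ph t s * (deriv f s + Complex.I * t * f s) := by
      ext s
      have := ((hasDerivAt_ph t s).mul (hf.differentiable (by simp) s).hasDerivAt).deriv
      rw [show (fun s => ph t s * f s) = ph t * f from rfl, this]
      ring
    rw [iteratedDeriv_succ', hd]
    refine (ih (A := (1 + |t|) * A) (f := fun s => deriv f s + Complex.I * t * f s) ?_ ?_ s).trans ?_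
    · exact (contDiff_deriv hf).add (contDiff_const.mul hf)
    · intro j hj s
      rw [iteratedDeriv_fun_add, iteratedDeriv_const_mul_field, ← iteratedDeriv_succ']
      · have h1 := h j (by omega) s
        have h2 := h (j + 1) (by omega) s
        refine (norm_add_le _ _).trans ?_
        rw [norm_mul, norm_mul, Complex.norm_I, Complex.norm_real, Real.norm_eq_abs, one_mul]
        nlinarith [abs_nonneg t, mul_le_mul_of_nonneg_left h1 (abs_nonneg t)]
      · exact ((contDiff_deriv hf).of_le (by exact_mod_cast le_top)).contDiffAt
      · exact ((contDiff_const.mul hf).of_le (by exact_mod_cast le_top)).contDiffAt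
    · apply le_of_eq; ring

lemma DB_ph_mul' (t : ℝ) (L : ℕ) {A : ℝ} (hA : 0 ≤ A) {f : ℝ → ℂ} (hf : ContDiff ℝ ∞ f)
    (h : DB L A f) : DB L ((1 + |t|) ^ L * A) (fun s => ph t s * f s) := by
  intro j hj s
  refine (DB_ph_mul t j hf (fun i hi => h i (hi.trans hj)) s).trans ?_
  gcongr
  linarith [abs_nonneg t]

lemma fourier_inversion {f : ℝ → ℂ} (hf : Continuous f) (hc : HasCompactSupport f)
    (hi : Integrable (fun ξ => ∫ s, ph ξ s * f s)) :
    ∫ ξ, ∫ s, ph ξ s * f s = 2 * π * f 0 := by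
  have hF : ∀ w, FourierTransform.fourier f w = ∫ s, ph (-(2 * π) * w) s * f s := by
    intro w
    rw [Real.fourier_eq']
    congr 1; ext s
    simp only [smul_eq_mul, ph]
    congr 2
    simp
    ring
  have hF' : FourierTransform.fourier f = fun w => (fun ξ => ∫ s, ph ξ s * f s) (-(2 * π) * w) :=
    funext hF
  have hne : -(2 * π) ≠ 0 := neg_ne_zero.2 (by positivity)
  have hFi : Integrable (FourierTransform.fourier f) := by
    rw [hF']
    exact hi.comp_mul_left' hne
  have h := congrFun (hf.fourierInv_fourier_eq (hf.integrable_of_hasCompactSupport hc) hFi) 0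
  rw [Real.fourierInv_eq'] at h
  simp only [inner_zero_right, mul_zero, Complex.ofReal_zero, zero_mul, Complex.exp_zero,
    one_smul] at h
  rw [hF', Measure.integral_comp_mul_left (fun ξ => ∫ s, ph ξ s * f s)] at h
  rw [← h]
  rw [abs_inv, abs_neg, abs_of_pos (by positivity), Complex.real_smul]
  have : (π : ℂ) ≠ 0 := by exact_mod_cast Real.pi_ne_zero
  push_cast
  field_simp

/-- smoothness with parameters -/
lemma contDiff_param_deriv {P : Type*} [NormedAddCommGroup P] [NormedSpace ℝ P]
    {F : ℝ × P → ℂ} (hF : ContDiff ℝ ∞ F) :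
    ContDiff ℝ ∞ (fun q : ℝ × P => deriv (fun s => F (s, q.2)) q.1) := by
  have : (fun q : ℝ × P => deriv (fun s => F (s, q.2)) q.1)
      = fun q => fderiv ℝ F q ((1 : ℝ), (0 : P)) := by
    ext q
    have h1 : HasDerivAt (fun s : ℝ => (s, q.2)) ((1 : ℝ), (0 : P)) q.1 :=
      (hasDerivAt_id _).prodMk (hasDerivAt_const _ _)
    have h2 := (hF.differentiable (by simp) (q.1, q.2)).hasFDerivAt.comp_hasDerivAt q.1 h1
    exact h2.deriv
  rw [this]
  exact (hF.fderiv_right (m := ∞) (by simp)).clm_apply contDiff_const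

lemma contDiff_param_iter {P : Type*} [NormedAddCommGroup P] [NormedSpace ℝ P] (K : ℕ)
    {F : ℝ × P → ℂ} (hF : ContDiff ℝ ∞ F) :
    ContDiff ℝ ∞ (fun q : ℝ × P => (oneAddDsq^[K] (fun s => F (s, q.2))) q.1) := by
  induction K generalizing F with
  | zero => exact hF
  | succ K ih =>
    exact ih (F := fun q : ℝ × P => oneAddDsq (fun s => F (s, q.2)) q.1)
      (hF.sub (contDiff_param_deriv (contDiff_param_deriv hF)))

structure Amp {Z : Type*} [NormedAddCommGroup Z] [NormedSpace ℝ Z] (m R : ℝ)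
    (b : Z → ℝ → ℝ → ℝ → ℂ) : Prop where
  smooth : ContDiff ℝ ∞ (fun q : ℝ × ((Z × ℝ) × ℝ) => b q.2.1.1 q.2.1.2 q.2.2 q.1)
  hR : 0 ≤ R
  suppz : ∀ z σ μ s, R < ‖z‖ → b z σ μ s = 0
  suppm : ∀ z σ μ s, R < |μ| → b z σ μ s = 0
  supps : ∀ z σ μ s, R < |s| → b z σ μ s = 0
  bd : ∀ L, ∃ C ≥ 0, ∀ z σ μ, DB L (C * (1 + |σ|) ^ m) (b z σ μ)
  bd2 : ∀ L, ∃ C ≥ 0, ∀ z σ μ μ', DB L (C * |μ - μ'| * (1 + |σ|) ^ m)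
    (fun s => b z σ μ s - b z σ μ' s)

def Osc {Z : Type*} (b : Z → ℝ → ℝ → ℝ → ℂ) (h : ℝ) (K : ℕ) (q : ((Z × ℝ) × ℝ) × ℝ) : ℂ :=
  ph q.1.1.2 q.2 * (Complex.ofReal (1 + q.1.1.2 ^ 2))⁻¹ ^ K *
    (oneAddDsq^[K] (fun s => ph (-(h * q.1.2)) s * b q.1.1.1 q.1.1.2 q.1.2 s)) q.2

def G {Z : Type*} (b : Z → ℝ → ℝ → ℝ → ℂ) (z : Z) (σ μ ξ : ℝ) : ℂ := ∫ s, ph ξ s * b z σ μ s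

section
variable {Z : Type*} [NormedAddCommGroup Z] [NormedSpace ℝ Z] {m R : ℝ} {b : Z → ℝ → ℝ → ℝ → ℂ}

lemma Amp.smooth_s (H : Amp m R b) (z : Z) (σ μ : ℝ) : ContDiff ℝ ∞ (b z σ μ) :=
  H.smooth.comp (f := fun s : ℝ => (s, ((z, σ), μ))) (contDiff_id.prodMk contDiff_const)

lemma Amp.hcs (H : Amp m R b) (z : Z) (σ μ : ℝ) : HasCompactSupport (b z σ μ) :=
  hasCompactSupport_of (H.supps z σ μ)

lemma osc_int_s (H : Amp m R b) (h : ℝ) (K : ℕ) (z : Z) (σ μ : ℝ) :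
    ∫ s, Osc b h K (((z, σ), μ), s) = G b z σ μ (σ - h * μ) := by
  have h0 : ∀ s, Osc b h K (((z, σ), μ), s) = (Complex.ofReal (1 + σ ^ 2))⁻¹ ^ K *
      (ph σ s * (oneAddDsq^[K] (fun s => ph (-(h * μ)) s * b z σ μ s)) s) := by
    intro s; simp only [Osc]; ring
  simp_rw [h0]
  rw [integral_const_mul, ibpK K ((contDiff_ph _).mul (H.smooth_s z σ μ)) (H.hcs z σ μ).mul_left,
    ← mul_assoc, ← mul_pow, inv_mul_cancel₀, one_pow, one_mul]
  · unfold G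
    congr 1; ext s
    rw [← mul_assoc]
    congr 1
    unfold ph
    rw [← Complex.exp_add]
    congr 1
    push_cast; ring
  · exact_mod_cast (by positivity : (1 + σ ^ 2 : ℝ) ≠ 0)

lemma G_bound (H : Amp m R b) (M : ℕ) : ∃ C ≥ 0, ∀ z σ μ ξ,
    ‖G b z σ μ ξ‖ ≤ C * (1 + |σ|) ^ m * ((1 + ξ ^ 2)⁻¹) ^ M := by
  obtain ⟨C, hC, hb⟩ := H.bd (2 * M)
  have := H.hR
  refine ⟨2 ^ M * C * (2 * R), by positivity, fun z σ μ ξ => ?_⟩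
  refine (decay M (H.smooth_s z σ μ) H.hR (H.supps z σ μ) (hb z σ μ) ξ).trans (le_of_eq ?_)
  ring

lemma G_bound2 (H : Amp m R b) (M : ℕ) : ∃ C ≥ 0, ∀ z σ μ μ' ξ,
    ‖G b z σ μ ξ - G b z σ μ' ξ‖ ≤ C * |μ - μ'| * (1 + |σ|) ^ m * ((1 + ξ ^ 2)⁻¹) ^ M := by
  obtain ⟨C, hC, hb⟩ := H.bd2 (2 * M)
  have := H.hR
  refine ⟨2 ^ M * C * (2 * R), by positivity, fun z σ μ μ' ξ => ?_⟩
  have hi : ∀ μ, Integrable (fun s => ph ξ s * b z σ μ s) := fun μ =>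
    ((continuous_ph ξ).mul (H.smooth_s z σ μ).continuous).integrable_of_hasCompactSupport
      (H.hcs z σ μ).mul_left
  unfold G
  rw [← integral_sub (hi μ) (hi μ')]
  simp_rw [← mul_sub]
  refine (decay M (f := fun s => b z σ μ s - b z σ μ' s)
    ((H.smooth_s z σ μ).sub (H.smooth_s z σ μ')) H.hR ?_ (hb z σ μ μ') ξ).trans (le_of_eq ?_)
  · intro s hs
    rw [H.supps _ _ _ _ hs, H.supps _ _ _ _ hs, sub_zero]
  · ring

lemma G_zero_z (H : Amp m R b) (z : Z) (σ μ ξ : ℝ) (h : R < ‖z‖) : G b z σ μ ξ = 0 := by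
  unfold G
  simp [H.suppz _ _ _ _ h]

lemma G_zero_m (H : Amp m R b) (z : Z) (σ μ ξ : ℝ) (h : R < |μ|) : G b z σ μ ξ = 0 := by
  unfold G
  simp [H.suppm _ _ _ _ h]

lemma G_meas (H : Amp m R b) (z : Z) (σ : ℝ) {g : ℝ → ℝ} (hg : Continuous g) :
    AEStronglyMeasurable (fun ξ => G b z σ (g ξ) ξ) := by
  have hc : Continuous (fun q : ℝ × ℝ => ph q.1 q.2 * b z σ (g q.1) q.2) := by
    apply contDiff_ph2.continuous.mul
    exact H.smooth.continuous.comp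
      (by fun_prop : Continuous (fun q : ℝ × ℝ => (q.2, ((z, σ), g q.1))))
  exact (hc.stronglyMeasurable.integral_prod_right').aestronglyMeasurable

lemma G_integrable (H : Amp m R b) (z : Z) (σ : ℝ) {g : ℝ → ℝ} (hg : Continuous g) :
    Integrable (fun ξ => G b z σ (g ξ) ξ) := by
  obtain ⟨C, hC, hb⟩ := G_bound H 1
  refine (integrable_inv_one_add_sq.const_mul (C * (1 + |σ|) ^ m)).mono' (G_meas H z σ hg) ?_
  filter_upwards with ξ
  simpa using hb z σ (g ξ) ξ

lemma rpow_bound {m : ℝ} (hm : 0 ≤ m) {K : ℕ} (hK : m / 2 + 1 ≤ K) (σ : ℝ) :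
    (1 + |σ|) ^ m * ((1 + σ ^ 2)⁻¹) ^ K ≤ 2 ^ m * (1 + σ ^ 2)⁻¹ := by
  have hp : 0 < 1 + σ ^ 2 := by positivity
  have hp1 : 1 ≤ 1 + σ ^ 2 := by nlinarith [sq_nonneg σ]
  have h1 : (1 + |σ|) ^ m ≤ 2 ^ m * (1 + σ ^ 2) ^ (m / 2) := by
    have : (1 + |σ|) ≤ 2 * (1 + σ ^ 2) ^ (1 / 2 : ℝ) := by
      rw [← Real.sqrt_eq_rpow]
      have : 1 ≤ √(1 + σ ^ 2) := Real.one_le_sqrt.2 hp1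
      have : |σ| ≤ √(1 + σ ^ 2) := Real.abs_le_sqrt (by linarith)
      linarith
    calc (1 + |σ|) ^ m ≤ (2 * (1 + σ ^ 2) ^ (1 / 2 : ℝ)) ^ m :=
          Real.rpow_le_rpow (by positivity) this hm
      _ = _ := by
          rw [Real.mul_rpow (by norm_num) (by positivity), ← Real.rpow_mul hp.le]
          congr 2; ring
  have h2 : (1 + σ ^ 2) ^ (m / 2) * ((1 + σ ^ 2)⁻¹) ^ K ≤ (1 + σ ^ 2)⁻¹ := by
    rw [inv_pow, ← Real.rpow_natCast (1 + σ ^ 2) K, ← Real.rpow_neg hp.le, ← Real.rpow_add hp,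
      ← Real.rpow_neg_one]
    exact Real.rpow_le_rpow_of_exponent_le hp1 (by linarith)
  calc _ ≤ 2 ^ m * (1 + σ ^ 2) ^ (m / 2) * ((1 + σ ^ 2)⁻¹) ^ K := by gcongr
    _ = 2 ^ m * ((1 + σ ^ 2) ^ (m / 2) * ((1 + σ ^ 2)⁻¹) ^ K) := by ring
    _ ≤ _ := by gcongr

end

section
variable {Z : Type*} [NormedAddCommGroup Z] [NormedSpace ℝ Z] [MeasureSpace Z] [BorelSpace Z]
  [ProperSpace Z] [SecondCountableTopology Z] [SFinite (volume : Measure Z)]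
  [IsFiniteMeasureOnCompacts (volume : Measure Z)]
  {m R : ℝ} {b : Z → ℝ → ℝ → ℝ → ℂ}

lemma ind_integrable (E : Type*) [NormedAddCommGroup E] [MeasureSpace E] [BorelSpace E]
  [ProperSpace E] [IsFiniteMeasureOnCompacts (volume : Measure E)] (R : ℝ) :
    Integrable (Set.indicator (Metric.closedBall (0 : E) R) (fun _ => (1 : ℝ))) := by
  rw [integrable_indicator_iff Metric.isClosed_closedBall.measurableSet]
  exact integrableOn_const (isCompact_closedBall _ _).measure_lt_top.ne

lemma osc_continuous (H : Amp m R b) (h : ℝ) (K : ℕ) : Continuous (Osc b h K) := by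
  unfold Osc
  refine (Continuous.mul ?_ ?_).mul ?_
  · exact contDiff_ph2.continuous.comp
      (by fun_prop : Continuous (fun q : ((Z × ℝ) × ℝ) × ℝ => (q.1.1.2, q.2)))
  · refine (Continuous.inv₀ (by fun_prop) ?_).pow K
    intro q
    exact_mod_cast (by positivity : (1 + q.1.1.2 ^ 2 : ℝ) ≠ 0)
  · have hF : ContDiff ℝ ∞ (fun q : ℝ × ((Z × ℝ) × ℝ) =>
        ph (-(h * q.2.2)) q.1 * b q.2.1.1 q.2.1.2 q.2.2 q.1) := by
      refine ContDiff.mul ?_ H.smooth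
      exact contDiff_ph2.comp (by fun_prop : ContDiff ℝ ∞ (fun q : ℝ × ((Z × ℝ) × ℝ) =>
        (-(h * q.2.2), q.1)))
    exact (contDiff_param_iter K hF).continuous.comp
      (by fun_prop : Continuous (fun q : ((Z × ℝ) × ℝ) × ℝ => (q.2, q.1)))

lemma iter_zero (K : ℕ) (s : ℝ) : (oneAddDsq^[K] (fun _ => (0:ℂ))) s = 0 :=
  iter_eq_zero (R := -1) K (fun _ _ => rfl) s (by linarith [abs_nonneg s])

lemma osc_integrable (H : Amp m R b) (hm : 0 ≤ m) (h : ℝ) {K : ℕ} (hK : m / 2 + 1 ≤ K) :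
    Integrable (Osc b h K) := by
  obtain ⟨C, hC, hb⟩ := H.bd (2 * K)
  set D := 2 ^ K * ((1 + |h| * R) ^ (2 * K) * C * 2 ^ m) with hD
  have hR := H.hR
  have hDn : 0 ≤ D := by positivity
  have hi := ((((ind_integrable Z R).mul_prod integrable_inv_one_add_sq).mul_prod
    (ind_integrable ℝ R)).mul_prod (ind_integrable ℝ R)).const_mul D
  refine hi.mono' (osc_continuous H h K).aestronglyMeasurable ?_
  filter_upwards with q
  obtain ⟨⟨⟨z, σ⟩, μ⟩, s⟩ := q
  by_cases hz : ‖z‖ ≤ R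
  swap
  · have : Osc b h K (((z, σ), μ), s) = 0 := by
      simp only [Osc]
      simp_rw [H.suppz z σ μ _ (not_le.1 hz), mul_zero]
      rw [iter_zero, mul_zero]
    rw [this]; simp [hz]
  by_cases hμ : |μ| ≤ R
  swap
  · have : Osc b h K (((z, σ), μ), s) = 0 := by
      simp only [Osc]
      simp_rw [H.suppm z σ μ _ (not_le.1 hμ), mul_zero]
      rw [iter_zero, mul_zero]
    rw [this]; simp [hμ]
  by_cases hs : |s| ≤ R
  swap
  · have : Osc b h K (((z, σ), μ), s) = 0 := by
      simp only [Osc]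
      rw [iter_eq_zero (R := R) K _ s (not_le.1 hs), mul_zero]
      intro s hs
      rw [H.supps _ _ _ _ hs, mul_zero]
    rw [this]; simp [hs]
  have e1 : Set.indicator (Metric.closedBall (0 : Z) R) (fun _ => (1 : ℝ)) z = 1 := by simp [hz]
  have e2 : Set.indicator (Metric.closedBall (0 : ℝ) R) (fun _ => (1 : ℝ)) μ = 1 := by simp [hμ]
  have e3 : Set.indicator (Metric.closedBall (0 : ℝ) R) (fun _ => (1 : ℝ)) s = 1 := by simp [hs]
  simp only [e1, e2, e3, one_mul, mul_one]
  have hσ : 0 < 1 + σ ^ 2 := by positivity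
  have hA : 0 ≤ C * (1 + |σ|) ^ m := by positivity
  have k1 := DB_oneAddDsq_iter (L := 0) K
    ((contDiff_ph (-(h * μ))).mul (H.smooth_s z σ μ))
    (by simpa using DB_ph_mul' (-(h * μ)) (2 * K) hA (H.smooth_s z σ μ) (hb z σ μ)) 0 le_rfl s
  simp only [iteratedDeriv_zero] at k1
  simp only [Osc]
  rw [norm_mul, norm_mul, norm_ph, one_mul, norm_pow, norm_inv, Complex.norm_real,
    Real.norm_of_nonneg hσ.le]
  have k2 : (1 + |-(h * μ)|) ^ (2 * K) ≤ (1 + |h| * R) ^ (2 * K) := by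
    rw [abs_neg, abs_mul]; gcongr
  calc _ ≤ (1 + σ ^ 2)⁻¹ ^ K * (2 ^ K * ((1 + |h| * R) ^ (2 * K) * (C * (1 + |σ|) ^ m))) := by
        refine mul_le_mul_of_nonneg_left (k1.trans ?_) (by positivity)
        gcongr
    _ = 2 ^ K * ((1 + |h| * R) ^ (2 * K) * C) * ((1 + |σ|) ^ m * ((1 + σ ^ 2)⁻¹) ^ K) := by ring
    _ ≤ 2 ^ K * ((1 + |h| * R) ^ (2 * K) * C) * (2 ^ m * (1 + σ ^ 2)⁻¹) := by
        exact mul_le_mul_of_nonneg_left (rpow_bound hm hK σ) (by positivity)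
    _ = _ := by rw [hD]; ring

lemma diff_bound (H : Amp m R b) (hm : 0 ≤ m) : ∃ D ≥ 0, ∀ ℏ, 0 < ℏ → ℏ ≤ 1 → ∀ z σ ξ,
    ‖G b z σ (ℏ * (σ - ξ)) ξ - G b z σ (ℏ * σ) ξ‖ ≤
      (D * ℏ ^ (1 - m)) * (Set.indicator (Metric.closedBall (0 : Z) R) (fun _ => (1 : ℝ)) z *
        (1 + (ℏ * σ) ^ 2)⁻¹) * (1 + ξ ^ 2)⁻¹ := by
  set N := ⌈m⌉₊ with hN
  obtain ⟨C, hC, hb⟩ := G_bound2 H (N + 3)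
  have hR := H.hR
  refine ⟨C * ((1 + R) ^ m * 2 ^ m) * (2 * (1 + R ^ 2)), by positivity, ?_⟩
  intro ℏ h0 h1 z σ ξ
  by_cases hz : ‖z‖ ≤ R
  swap
  · rw [G_zero_z H _ _ _ _ (not_le.1 hz), G_zero_z H _ _ _ _ (not_le.1 hz)]
    simp [hz]
  have e1 : Set.indicator (Metric.closedBall (0 : Z) R) (fun _ => (1 : ℝ)) z = 1 := by simp [hz]
  rw [e1, one_mul]
  by_cases hσ : |ℏ * σ| ≤ R + |ξ|
  swap
  · have hx : |ℏ * ξ| ≤ |ξ| := by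
      rw [abs_mul, abs_of_pos h0]
      nlinarith [abs_nonneg ξ]
    have a1 : R < |ℏ * σ| := by linarith [abs_nonneg ξ]
    have a2 : R < |ℏ * (σ - ξ)| := by
      have := abs_sub_abs_le_abs_sub (ℏ * σ) (ℏ * ξ)
      rw [mul_sub]; linarith
    rw [G_zero_m H _ _ _ _ a1, G_zero_m H _ _ _ _ a2]
    simp only [sub_zero, norm_zero]
    positivity
  have b0 := hb z σ (ℏ * (σ - ξ)) (ℏ * σ) ξ
  have b1 : |ℏ * (σ - ξ) - ℏ * σ| = ℏ * |ξ| := by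
    rw [show ℏ * (σ - ξ) - ℏ * σ = -(ℏ * ξ) by ring, abs_neg, abs_mul, abs_of_pos h0]
  rw [b1] at b0
  have hx : 0 < 1 + ξ ^ 2 := by positivity
  have hx1 : 1 ≤ 1 + ξ ^ 2 := by nlinarith [sq_nonneg ξ]
  have b2 : |ξ| ≤ 1 + ξ ^ 2 := by nlinarith [sq_abs ξ, sq_nonneg (|ξ| - 1)]
  have b3 : (1 + |σ|) ^ m ≤ ℏ ^ (-m) * ((1 + R) ^ m * 2 ^ m) * (1 + ξ ^ 2) ^ N := by
    have c1 : 1 + |σ| ≤ ℏ⁻¹ * ((1 + R) * (2 * (1 + ξ ^ 2))) := by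
      rw [inv_mul_eq_div, le_div_iff₀ h0]
      rw [abs_mul, abs_of_pos h0] at hσ
      nlinarith [abs_nonneg ξ, mul_nonneg hR (abs_nonneg ξ), mul_nonneg hR (sq_nonneg ξ)]
    calc (1 + |σ|) ^ m ≤ (ℏ⁻¹ * ((1 + R) * (2 * (1 + ξ ^ 2)))) ^ m :=
          Real.rpow_le_rpow (by positivity) c1 hm
      _ = ℏ ^ (-m) * ((1 + R) ^ m * 2 ^ m) * (1 + ξ ^ 2) ^ m := by
          rw [Real.mul_rpow (by positivity) (by positivity),
            Real.mul_rpow (by positivity) (by positivity),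
            Real.mul_rpow (by positivity) (by positivity), Real.inv_rpow h0.le,
            Real.rpow_neg h0.le]
          ring
      _ ≤ _ := by
          gcongr
          rw [← Real.rpow_natCast (1 + ξ ^ 2) N]
          exact Real.rpow_le_rpow_of_exponent_le hx1 (Nat.le_ceil m)
  have b4 : 1 ≤ (1 + (ℏ * σ) ^ 2)⁻¹ * (2 * (1 + R ^ 2) * (1 + ξ ^ 2)) := by
    rw [inv_mul_eq_div, le_div_iff₀ (by positivity)]
    have : (ℏ * σ) ^ 2 ≤ (R + |ξ|) ^ 2 := by
      rw [← sq_abs (ℏ * σ)]; gcongr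
    nlinarith [sq_nonneg (R - |ξ|), sq_abs ξ, mul_nonneg (sq_nonneg R) (sq_nonneg ξ)]
  have b5 : ℏ ^ (1 - m) = ℏ * ℏ ^ (-m) := by
    rw [sub_eq_add_neg, Real.rpow_add h0, Real.rpow_one]
  calc _ ≤ C * (ℏ * |ξ|) * (1 + |σ|) ^ m * ((1 + ξ ^ 2)⁻¹) ^ (N + 3) := b0
    _ ≤ C * (ℏ * (1 + ξ ^ 2)) * (ℏ ^ (-m) * ((1 + R) ^ m * 2 ^ m) * (1 + ξ ^ 2) ^ N)
        * ((1 + ξ ^ 2)⁻¹) ^ (N + 3) * 1 := by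
        rw [mul_one]
        gcongr
    _ ≤ C * (ℏ * (1 + ξ ^ 2)) * (ℏ ^ (-m) * ((1 + R) ^ m * 2 ^ m) * (1 + ξ ^ 2) ^ N)
        * ((1 + ξ ^ 2)⁻¹) ^ (N + 3) *
        ((1 + (ℏ * σ) ^ 2)⁻¹ * (2 * (1 + R ^ 2) * (1 + ξ ^ 2))) := by
        gcongr
    _ = _ := by
        rw [b5, pow_add]
        have : (1 + ξ ^ 2) ^ N * (1 + ξ ^ 2)⁻¹ ^ N = 1 := by
          rw [← mul_pow, mul_inv_cancel₀ hx.ne', one_pow]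
        have h3 : (1 + ξ ^ 2) * (1 + ξ ^ 2) * (1 + ξ ^ 2)⁻¹ ^ 3 = (1 + ξ ^ 2)⁻¹ := by
          field_simp
        linear_combination (C * ℏ * ℏ ^ (-m) * ((1 + R) ^ m * 2 ^ m) * (2 * (1 + R ^ 2))
          * (1 + (ℏ * σ) ^ 2)⁻¹) * (((1 + ξ ^ 2) * (1 + ξ ^ 2) * (1 + ξ ^ 2)⁻¹ ^ 3) * this + h3)

lemma core (H : Amp m R b) (hm : 0 ≤ m) {K : ℕ} (hK : m / 2 + 1 ≤ K) :
    ∃ D ≥ 0, ∀ ℏ, 0 < ℏ → ℏ ≤ 1 →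
      ‖(∫ q, Osc b ℏ⁻¹ K q) - 2 * π * ∫ q : Z × ℝ, b q.1 (ℏ⁻¹ * q.2) q.2 0‖
        ≤ D * ℏ ^ (1 - m) := by
  obtain ⟨D, hD, hd⟩ := diff_bound H hm
  set V := ∫ z, Set.indicator (Metric.closedBall (0 : Z) R) (fun _ => (1 : ℝ)) z with hV
  have hVn : 0 ≤ V := integral_nonneg (fun z => Set.indicator_nonneg (fun _ _ => zero_le_one) z)
  refine ⟨D * V * π * π, by positivity, fun ℏ h0 h1 => ?_⟩
  have hne := h0.ne'
  have hoi := osc_integrable H hm ℏ⁻¹ hK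
  set A1 : Z × ℝ → ℂ := fun q => ∫ ξ, G b q.1 q.2 (ℏ * (q.2 - ξ)) ξ with hA1
  set B1 : Z × ℝ → ℂ := fun q => ∫ ξ, G b q.1 q.2 (ℏ * q.2) ξ with hB1
  have hg1 : ∀ q : Z × ℝ, ∫ μ, ∫ s, Osc b ℏ⁻¹ K ((q, μ), s) = ℏ * A1 q := by
    rintro ⟨z, σ⟩
    simp_rw [osc_int_s H]
    have := integral_sub_left_eq_self
      (fun x => (fun μ => G b z σ μ (σ - ℏ⁻¹ * μ)) (ℏ * x)) volume σ
    rw [Measure.integral_comp_mul_left (fun μ => G b z σ μ (σ - ℏ⁻¹ * μ))] at this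
    have e : ∀ ξ, σ - ℏ⁻¹ * (ℏ * (σ - ξ)) = ξ := by intro ξ; field_simp; ring
    simp only [e] at this
    simp only [hA1]
    rw [this, abs_of_pos (by positivity), Complex.real_smul]
    have : (ℏ : ℂ) ≠ 0 := by exact_mod_cast hne
    push_cast
    field_simp
  have hA1i : Integrable A1 := by
    have h2 := (hoi.integral_prod_left).integral_prod_left
    simp_rw [hg1] at h2
    have h3 := h2.const_mul ((ℏ : ℂ)⁻¹)
    refine h3.congr ?_
    filter_upwards with q
    have : (ℏ : ℂ) ≠ 0 := by exact_mod_cast hne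
    field_simp
  have hOsc : ∫ q, Osc b ℏ⁻¹ K q = ℏ * ∫ q, A1 q := by
    rw [← integral_const_mul]
    simp_rw [← hg1]
    rw [Measure.volume_eq_prod, integral_prod _ hoi, Measure.volume_eq_prod,
      integral_prod _ hoi.integral_prod_left]
  have hB1e : ∀ q, B1 q = 2 * π * b q.1 q.2 (ℏ * q.2) 0 := by
    intro q
    exact fourier_inversion (H.smooth_s _ _ _).continuous (H.hcs _ _ _)
      (G_integrable H q.1 q.2 continuous_const)
  have hcb : ∀ c d : ℝ, Continuous (fun q : Z × ℝ => b q.1 (c * q.2) (d * q.2) 0) := by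
    intro c d
    exact H.smooth.continuous.comp
      (by fun_prop : Continuous (fun q : Z × ℝ => ((0 : ℝ), ((q.1, c * q.2), d * q.2))))
  have hib : ∀ c d : ℝ, 0 < d → Integrable (fun q : Z × ℝ => b q.1 (c * q.2) (d * q.2) 0) := by
    intro c d hd
    refine (hcb c d).integrable_of_hasCompactSupport ?_
    apply HasCompactSupport.intro ((isCompact_closedBall (0 : Z) R).prod
      (isCompact_closedBall (0 : ℝ) (R / d)))
    rintro ⟨z, μ⟩ hq
    by_cases hz : ‖z‖ ≤ R
    · apply H.suppm
      simp only [Set.mem_prod, Metric.mem_closedBall, dist_zero_right, hz, true_and, not_le,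
        Real.norm_eq_abs] at hq
      rw [div_lt_iff₀ hd] at hq
      rw [abs_mul, abs_of_pos hd]; linarith
    · exact H.suppz _ _ _ _ (not_le.1 hz)
  have hB1i : Integrable B1 := by
    rw [funext hB1e]
    have := (hib 1 ℏ h0).const_mul (2 * π : ℂ)
    simpa only [one_mul] using this
  have hb : 2 * π * ∫ q : Z × ℝ, b q.1 (ℏ⁻¹ * q.2) q.2 0 = ℏ * ∫ q, B1 q := by
    simp_rw [hB1e]
    rw [integral_const_mul]
    have i1 := hib ℏ⁻¹ 1 one_pos
    have i2 := hib 1 ℏ h0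
    simp only [one_mul] at i1 i2
    rw [Measure.volume_eq_prod, integral_prod _ i1, integral_prod _ i2]
    have : ∀ z, ∫ σ, b z σ (ℏ * σ) 0 = (ℏ : ℂ)⁻¹ * ∫ μ, b z (ℏ⁻¹ * μ) μ 0 := by
      intro z
      have := Measure.integral_comp_mul_left (fun μ => b z (ℏ⁻¹ * μ) μ 0) ℏ
      simp only [inv_mul_cancel_left₀ hne] at this
      rw [this, abs_of_pos (by positivity), Complex.real_smul]
      push_cast; rfl
    simp_rw [this]
    rw [integral_const_mul]
    have : (ℏ : ℂ) ≠ 0 := by exact_mod_cast hne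
    field_simp
  rw [hOsc, hb, ← mul_sub, ← integral_sub hA1i hB1i, norm_mul, Complex.norm_real,
    Real.norm_of_nonneg h0.le]
  have hsq : Integrable (fun σ : ℝ => (1 + (ℏ * σ) ^ 2)⁻¹) :=
    integrable_inv_one_add_sq.comp_mul_left' hne
  have key : ‖∫ q, (A1 q - B1 q)‖ ≤ ∫ q : Z × ℝ, (D * ℏ ^ (1 - m) * π) *
      (Set.indicator (Metric.closedBall (0 : Z) R) (fun _ => (1 : ℝ)) q.1 *
        (1 + (ℏ * q.2) ^ 2)⁻¹) := by
    refine norm_integral_le_of_norm_le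
      (((ind_integrable Z R).mul_prod hsq).const_mul _) ?_
    filter_upwards with q
    simp only [hA1, hB1]
    rw [← integral_sub (G_integrable H q.1 q.2 (by fun_prop))
      (G_integrable H q.1 q.2 continuous_const)]
    refine (norm_integral_le_of_norm_le (integrable_inv_one_add_sq.const_mul _)
      (Filter.Eventually.of_forall (fun ξ => hd ℏ h0 h1 q.1 q.2 ξ))).trans (le_of_eq ?_)
    rw [integral_const_mul, integral_univ_inv_one_add_sq]
    ring
  rw [integral_const_mul, Measure.volume_eq_prod, integral_prod_mul
    (Set.indicator (Metric.closedBall (0 : Z) R) (fun _ => (1 : ℝ)))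
    (fun σ : ℝ => (1 + (ℏ * σ) ^ 2)⁻¹), ← hV,
    Measure.integral_comp_mul_left (fun σ : ℝ => (1 + σ ^ 2)⁻¹),
    integral_univ_inv_one_add_sq, abs_of_pos (by positivity), smul_eq_mul] at key
  calc _ ≤ ℏ * (D * ℏ ^ (1 - m) * π * (V * (ℏ⁻¹ * π))) := mul_le_mul_of_nonneg_left key h0.le
    _ = _ := by field_simp

end

lemma line_bound {W : Type*} [NormedAddCommGroup W] [NormedSpace ℝ W] {f : W → ℂ}
    (hf : ContDiff ℝ ∞ f) {A : ℝ} (j : ℕ) (h : ∀ w, ‖iteratedFDeriv ℝ j f w‖ ≤ A)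
    (w0 e : W) (he : ‖e‖ ≤ 1) (s : ℝ) :
    ‖iteratedDeriv j (fun s : ℝ => f (s • e + w0)) s‖ ≤ A := by
  rw [← norm_iteratedFDeriv_eq_norm_iteratedDeriv]
  have e1 : (fun s : ℝ => f (s • e + w0))
      = (fun w => f (w + w0)) ∘ (ContinuousLinearMap.toSpanSingleton ℝ e) := by
    ext s; simp
  have hg : ContDiff ℝ ∞ (fun w => f (w + w0)) := hf.comp (contDiff_id.add contDiff_const)
  rw [e1, ContinuousLinearMap.iteratedFDeriv_comp_right _ hg s (by exact_mod_cast le_top)]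
  refine (ContinuousMultilinearMap.norm_compContinuousLinearMap_le _ _).trans ?_
  rw [iteratedFDeriv_comp_add_right]
  have h2 : ∏ _i : Fin j, ‖ContinuousLinearMap.toSpanSingleton ℝ e‖ ≤ 1 := by
    apply Finset.prod_le_one
    · intros; positivity
    · intros; simpa using he
  calc _ ≤ A * 1 := mul_le_mul (h _) h2 (by positivity) ((norm_nonneg _).trans (h 0))
    _ = A := mul_one A

lemma shift_bound {W : Type*} [NormedAddCommGroup W] [NormedSpace ℝ W] {f : W → ℂ}
    (hf : ContDiff ℝ ∞ f) {A : ℝ} (j : ℕ) (h : ∀ w, ‖iteratedFDeriv ℝ (j + 1) f w‖ ≤ A)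
    (v w : W) : ‖iteratedFDeriv ℝ j (fun w => f (w + v) - f w) w‖ ≤ A * ‖v‖ := by
  have hg : ContDiff ℝ ∞ (fun w => f (w + v)) := hf.comp (contDiff_id.add contDiff_const)
  have e : iteratedFDeriv ℝ j (fun w => f (w + v) - f w) w
      = iteratedFDeriv ℝ j f (w + v) - iteratedFDeriv ℝ j f w := by
    rw [← iteratedFDeriv_comp_add_right]
    exact iteratedFDeriv_sub_apply (hg.of_le (by exact_mod_cast le_top)).contDiffAt
      (hf.of_le (by exact_mod_cast le_top)).contDiffAt
  rw [e]
  have := Convex.norm_image_sub_le_of_norm_fderiv_le (𝕜 := ℝ) (f := iteratedFDeriv ℝ j f)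
    (C := A) (s := Set.univ) (x := w) (y := w + v)
    (fun x _ => (hf.differentiable_iteratedFDeriv (by exact_mod_cast ENat.natCast_lt_top j)) x)
    (fun x _ => by rw [norm_fderiv_iteratedFDeriv]; exact h x) convex_univ
    (Set.mem_univ _) (Set.mem_univ _)
  simpa using this

/-- amplitude restricted to the diagonal -/
def bb (n : ℕ) (a : (ℝ × (Fin (n+1) → ℝ) × (Fin (n+1) → ℝ) × (Fin (n+1) → ℝ)) → ℝ → ℂ)
    (z : (Fin (n+1) → ℝ) × (Fin n → ℝ)) (σ μ s : ℝ) : ℂ :=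
  a (s, z.1, z.1, Fin.cons μ z.2) σ

lemma norm_tail_le {n : ℕ} (μ : ℝ) (v : Fin n → ℝ) :
    ‖v‖ ≤ ‖(Fin.cons μ v : Fin (n+1) → ℝ)‖ := by
  rw [pi_norm_le_iff_of_nonneg (norm_nonneg _)]
  intro i
  simpa using norm_le_pi_norm (Fin.cons μ v : Fin (n+1) → ℝ) i.succ

lemma norm_head_le {n : ℕ} (μ : ℝ) (v : Fin n → ℝ) :
    |μ| ≤ ‖(Fin.cons μ v : Fin (n+1) → ℝ)‖ := by
  simpa using norm_le_pi_norm (Fin.cons μ v : Fin (n+1) → ℝ) 0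

lemma norm_cons_zero_le {n : ℕ} (μ : ℝ) :
    ‖(Fin.cons μ (0 : Fin n → ℝ) : Fin (n+1) → ℝ)‖ ≤ |μ| := by
  rw [pi_norm_le_iff_of_nonneg (abs_nonneg _)]
  intro i
  refine Fin.cases ?_ (fun i => ?_) i <;> simp

lemma amp_bb (n : ℕ) (m' : ℝ)
    (a : (ℝ × (Fin (n+1) → ℝ) × (Fin (n+1) → ℝ) × (Fin (n+1) → ℝ)) → ℝ → ℂ)
    (ha : IsAmplitude n m' a) : ∃ R, Amp m' R (bb n a) := by
  obtain ⟨hs, ⟨K, hK, hKz⟩, hbd⟩ := ha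
  obtain ⟨R, hR, hKR⟩ : ∃ R ≥ 0, K ⊆ Metric.closedBall 0 R := by
    obtain ⟨R, hR⟩ := hK.isBounded.subset_closedBall 0
    exact ⟨max R 0, le_max_right _ _, hR.trans (Metric.closedBall_subset_closedBall (le_max_left _ _))⟩
  have hz : ∀ w σ, R < ‖w‖ → a w σ = 0 := by
    intro w σ hw
    apply hKz
    intro h
    have := hKR h
    simp only [Metric.mem_closedBall, dist_zero_right] at this
    linarith
  have hsw : ∀ σ, ContDiff ℝ ∞ (fun w => a w σ) := fun σ =>
    hs.comp (contDiff_id.prodMk contDiff_const)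
  have hb0 : ∀ k, ∃ C ≥ 0, ∀ w σ, ‖iteratedFDeriv ℝ k (fun w => a w σ) w‖
      ≤ C * (1 + |σ|) ^ m' := by
    intro k
    obtain ⟨C, hC⟩ := hbd k 0
    refine ⟨|C|, abs_nonneg C, fun w σ => ?_⟩
    have := hC w σ
    simp only [iteratedDeriv_zero, Nat.cast_zero, sub_zero] at this
    refine this.trans ?_
    gcongr
    exact le_abs_self C
  choose C hC0 hC using hb0
  refine ⟨R, ⟨?_, hR, ?_, ?_, ?_, ?_, ?_⟩⟩
  · unfold bb
    refine hs.comp (f := fun q : ℝ × ((((Fin (n+1) → ℝ) × (Fin n → ℝ)) × ℝ) × ℝ) =>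
      ((q.1, q.2.1.1.1, q.2.1.1.1, (Fin.cons q.2.2 q.2.1.1.2 : Fin (n+1) → ℝ)), q.2.1.2)) ?_
    have hc : ContDiff ℝ ∞ (fun q : ℝ × ((((Fin (n+1) → ℝ) × (Fin n → ℝ)) × ℝ) × ℝ) =>
        (Fin.cons q.2.2 q.2.1.1.2 : Fin (n+1) → ℝ)) := by
      rw [contDiff_pi]
      intro i
      refine Fin.cases ?_ (fun i => ?_) i
      · simp only [Fin.cons_zero]; fun_prop
      · simp only [Fin.cons_succ]; fun_prop
    fun_prop
  · intro z σ μ s h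
    apply hz
    refine h.trans_le ?_
    simp only [Prod.norm_def]
    have := norm_tail_le μ z.2
    grind
  · intro z σ μ s h
    apply hz
    refine h.trans_le ?_
    simp only [Prod.norm_def]
    have := norm_head_le μ z.2
    grind
  · intro z σ μ s h
    apply hz
    refine h.trans_le ?_
    simp only [Prod.norm_def, Real.norm_eq_abs]
    grind
  · intro L
    refine ⟨∑ j ∈ Finset.range (L + 1), C j, Finset.sum_nonneg (fun j _ => hC0 j), ?_⟩
    intro z σ μ j hj s
    have e : bb n a z σ μ = fun s : ℝ => (fun w => a w σ) (s • ((1 : ℝ), (0 : Fin (n+1) → ℝ),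
        (0 : Fin (n+1) → ℝ), (0 : Fin (n+1) → ℝ)) + (0, z.1, z.1, Fin.cons μ z.2)) := by
      ext s; simp [bb]
    rw [e]
    refine (line_bound (hsw σ) j (fun w => hC j w σ) _ _ (by simp [Prod.norm_def]) s).trans ?_
    gcongr
    exact Finset.single_le_sum (f := C) (fun j _ => hC0 j) (Finset.mem_range.2 (by omega))
  · intro L
    refine ⟨∑ j ∈ Finset.range (L + 1), C (j + 1), Finset.sum_nonneg (fun j _ => hC0 _), ?_⟩
    intro z σ μ μ' j hj s
    set v : (ℝ × (Fin (n+1) → ℝ) × (Fin (n+1) → ℝ) × (Fin (n+1) → ℝ)) :=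
      (0, 0, 0, Fin.cons (μ - μ') (0 : Fin n → ℝ)) with hv
    have e : (fun s => bb n a z σ μ s - bb n a z σ μ' s)
        = fun s : ℝ => (fun w => a (w + v) σ - a w σ) (s • ((1 : ℝ), (0 : Fin (n+1) → ℝ),
        (0 : Fin (n+1) → ℝ), (0 : Fin (n+1) → ℝ)) + (0, z.1, z.1, Fin.cons μ' z.2)) := by
      ext s
      have e2 : (Fin.cons μ' z.2 + Fin.cons (μ - μ') (0 : Fin n → ℝ) : Fin (n+1) → ℝ)
          = Fin.cons μ z.2 := by
        ext i
        refine Fin.cases ?_ (fun i => ?_) i <;> simp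
      simp [bb, hv, e2]
    rw [e]
    have hvn : ‖v‖ ≤ |μ - μ'| := by
      have := norm_cons_zero_le (n := n) (μ - μ')
      simp only [hv, Prod.norm_def, norm_zero]
      grind
    have hsv : ContDiff ℝ ∞ (fun w => a (w + v) σ - a w σ) :=
      ((hsw σ).comp (contDiff_id.add contDiff_const)).sub (hsw σ)
    refine (line_bound hsv j (fun w => shift_bound (hsw σ) j (fun w => hC (j + 1) w σ) v w)
      _ _ (by simp [Prod.norm_def]) s).trans ?_
    have h1 : C (j + 1) ≤ ∑ j ∈ Finset.range (L + 1), C (j + 1) :=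
      Finset.single_le_sum (f := fun j => C (j + 1)) (fun j _ => hC0 _)
        (Finset.mem_range.2 (by omega))
    have h2 : 0 ≤ ∑ j ∈ Finset.range (L + 1), C (j + 1) := Finset.sum_nonneg (fun j _ => hC0 _)
    calc C (j + 1) * (1 + |σ|) ^ m' * ‖v‖
        ≤ (∑ j ∈ Finset.range (L + 1), C (j + 1)) * (1 + |σ|) ^ m' * |μ - μ'| := by gcongr
      _ = _ := by ring

/-- the reordering equivalence `(x,(s,p,σ)) ↦ ((((x,p'),σ),p₁),s)`. -/
def reo (n : ℕ) : (Fin (n+1) → ℝ) × (ℝ × (Fin (n+1) → ℝ) × ℝ) ≃ᵐ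
    ((((Fin (n+1) → ℝ) × (Fin n → ℝ)) × ℝ) × ℝ) × ℝ where
  toFun q := ((((q.1, fun i => q.2.2.1 i.succ), q.2.2.2), q.2.2.1 0), q.2.1)
  invFun q := (q.1.1.1.1, (q.2, Fin.cons q.1.2 q.1.1.1.2, q.1.1.2))
  left_inv q := by
    obtain ⟨x, s, p, σ⟩ := q
    simp only
    congr 3
    exact Fin.cons_self_tail p
  right_inv q := by
    obtain ⟨⟨⟨⟨x, p⟩, σ⟩, μ⟩, s⟩ := q
    simp
  measurable_toFun := by
    simp only [Equiv.coe_fn_mk]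
    fun_prop
  measurable_invFun := by
    simp only [Equiv.coe_fn_symm_mk]
    have : Measurable (fun q : ((((Fin (n+1) → ℝ) × (Fin n → ℝ)) × ℝ) × ℝ) × ℝ =>
        (Fin.cons q.1.2 q.1.1.1.2 : Fin (n+1) → ℝ)) := by
      rw [measurable_pi_iff]
      intro i
      refine Fin.cases ?_ (fun i => ?_) i
      · simp only [Fin.cons_zero]; fun_prop
      · simp only [Fin.cons_succ]; fun_prop
    fun_prop

lemma reo_mp (n : ℕ) : MeasurePreserving (reo n) volume volume := by
  have hp := volume_preserving_piFinSuccAbove (fun _ : Fin (n+1) => ℝ) 0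
  -- split p
  have m1 := (MeasurePreserving.id (volume : Measure (Fin (n+1) → ℝ))).prod
    ((MeasurePreserving.id (volume : Measure ℝ)).prod
      (hp.prod (MeasurePreserving.id (volume : Measure ℝ))))
  -- (x,(s,((μ,p'),σ))) : move s to the end
  have m2 := (Measure.measurePreserving_swap (μ := (volume : Measure ℝ))
    (ν := ((volume : Measure (ℝ × (Fin n → ℝ))).prod (volume : Measure ℝ))))
  have m3 := (Measure.measurePreserving_swap (μ := (volume : Measure ℝ))
    (ν := (volume : Measure (Fin n → ℝ)))).prod (MeasurePreserving.id (volume : Measure ℝ))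
  have m3' := measurePreserving_prodAssoc (volume : Measure (Fin n → ℝ)) (volume : Measure ℝ)
    (volume : Measure ℝ)
  have m3'' := (MeasurePreserving.id (volume : Measure (Fin n → ℝ))).prod
    (Measure.measurePreserving_swap (μ := (volume : Measure ℝ)) (ν := (volume : Measure ℝ)))
  have m4 := (m3''.comp (m3'.comp m3)).prod (MeasurePreserving.id (volume : Measure ℝ))
  have m5 := (MeasurePreserving.id (volume : Measure (Fin (n+1) → ℝ))).prod (m4.comp m2)
  -- now (x, ((p', (σ, μ)), s))
  have a1 := (measurePreserving_prodAssoc (volume : Measure (Fin (n+1) → ℝ))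
    ((volume : Measure (Fin n → ℝ)).prod ((volume : Measure ℝ).prod (volume : Measure ℝ)))
    (volume : Measure ℝ)).symm
  have a2 := ((measurePreserving_prodAssoc (volume : Measure (Fin (n+1) → ℝ))
    (volume : Measure (Fin n → ℝ)) ((volume : Measure ℝ).prod (volume : Measure ℝ))).symm).prod
    (MeasurePreserving.id (volume : Measure ℝ))
  have a3 := ((measurePreserving_prodAssoc ((volume : Measure (Fin (n+1) → ℝ)).prod
    (volume : Measure (Fin n → ℝ))) (volume : Measure ℝ) (volume : Measure ℝ)).symm).prod
    (MeasurePreserving.id (volume : Measure ℝ))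
  exact a3.comp (a2.comp (a1.comp (m5.comp m1)))

lemma osc_eq (n : ℕ) (a : (ℝ × (Fin (n+1) → ℝ) × (Fin (n+1) → ℝ) × (Fin (n+1) → ℝ)) → ℝ → ℂ)
    (ℏ : ℝ) (K : ℕ) (x : Fin (n+1) → ℝ) (q : ℝ × (Fin (n+1) → ℝ) × ℝ) :
    oscIntegrand n a ℏ x x K q = Osc (bb n a) ℏ⁻¹ K (reo n (x, q)) := by
  obtain ⟨s, p, σ⟩ := q
  have hc : (Fin.cons (p 0) (fun i : Fin n => p i.succ) : Fin (n+1) → ℝ) = p :=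
    Fin.cons_self_tail p
  have e : ∀ s, Complex.exp (-Complex.I * Complex.ofReal (ℏ⁻¹ * s * p 0)) = ph (-(ℏ⁻¹ * p 0)) s := by
    intro s
    unfold ph
    congr 1
    push_cast; ring
  simp only [oscIntegrand, Osc, reo, bb, MeasurableEquiv.coe_mk, Equiv.coe_fn_mk, hc, e]
  congr 2
  simp [ph]

end TraceAux

/-- trace asymptotics, `m' ≥ 0`: as `ℏ → 0⁺`,
`∫ u_ℏ(x,x) dx = (2πℏ)^{-(n+1)} · 2π · ∫ a(0,x,x,(μ,p'),ℏ⁻¹μ) dx dp' dμ + O(ℏ^{-(n+1)-m'+1})`. -/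
theorem statement3 (n : ℕ) (m' : ℝ)
    (a : (ℝ × (Fin (n+1) → ℝ) × (Fin (n+1) → ℝ) × (Fin (n+1) → ℝ)) → ℝ → ℂ)
    (ha : IsAmplitude n m' a) (hm : 0 ≤ m') :
    ∃ C > (0 : ℝ), ∃ ℏ₀ > (0 : ℝ), ∀ ℏ : ℝ, 0 < ℏ → ℏ ≤ ℏ₀ →
      ‖(∫ x : Fin (n+1) → ℝ, uh n m' a ℏ x x) -
          Complex.ofReal ((2 * π * ℏ) ^ (-((n : ℤ) + 1)) * (2 * π)) *
            ∫ q : (Fin (n+1) → ℝ) × (Fin n → ℝ) × ℝ,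
              a (0, q.1, q.1, Fin.cons q.2.2 q.2.1) (ℏ⁻¹ * q.2.2)‖
        ≤ C * ℏ ^ (-((n : ℝ) + 1) - m' + 1) := by
  obtain ⟨R, H⟩ := TraceAux.amp_bb n m' a ha
  have hK : m' / 2 + 1 ≤ (⌈m' / 2 + 1⌉₊ : ℝ) := Nat.le_ceil _
  obtain ⟨D, hD, hcore⟩ := TraceAux.core H hm hK
  refine ⟨(2 * π) ^ (-((n : ℤ) + 1)) * D + 1, by positivity, 1, one_pos, fun ℏ h0 h1 => ?_⟩
  have hmp := TraceAux.reo_mp n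
  have hoi := TraceAux.osc_integrable H hm ℏ⁻¹ hK
  have hoi' := (hmp.integrable_comp_emb (TraceAux.reo n).measurableEmbedding).2 hoi
  have e1 : ∫ x : Fin (n+1) → ℝ, uh n m' a ℏ x x
      = Complex.ofReal ((2 * π * ℏ) ^ (-((n : ℤ) + 1))) *
        ∫ q, TraceAux.Osc (TraceAux.bb n a) ℏ⁻¹ ⌈m' / 2 + 1⌉₊ q := by
    unfold uh
    rw [integral_const_mul, ← hmp.integral_comp']
    simp_rw [TraceAux.osc_eq]
    congr 1
    exact (integral_prod _ hoi').symm
  have e2 : ∫ q : (Fin (n+1) → ℝ) × (Fin n → ℝ) × ℝ,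
        a (0, q.1, q.1, Fin.cons q.2.2 q.2.1) (ℏ⁻¹ * q.2.2)
      = ∫ q : ((Fin (n+1) → ℝ) × (Fin n → ℝ)) × ℝ,
        TraceAux.bb n a q.1 (ℏ⁻¹ * q.2) q.2 0 := by
    have := measurePreserving_prodAssoc (volume : Measure (Fin (n+1) → ℝ))
      (volume : Measure (Fin n → ℝ)) (volume : Measure ℝ)
    exact (this.integral_comp' (fun q : (Fin (n+1) → ℝ) × (Fin n → ℝ) × ℝ =>
        a (0, q.1, q.1, Fin.cons q.2.2 q.2.1) (ℏ⁻¹ * q.2.2))).symm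
  have hpos : 0 < (2 * π * ℏ) ^ (-((n : ℤ) + 1)) := by positivity
  have hr : 0 < ℏ ^ (-((n : ℝ) + 1) - m' + 1) := by positivity
  rw [e1, e2, Complex.ofReal_mul, mul_assoc (Complex.ofReal _) (Complex.ofReal _), ← mul_sub, norm_mul, Complex.norm_real,
    Real.norm_of_nonneg hpos.le]
  have hc := hcore ℏ h0 h1
  have e3 : (2 * π * ℏ) ^ (-((n : ℤ) + 1)) * ℏ ^ (1 - m')
      = (2 * π) ^ (-((n : ℤ) + 1)) * ℏ ^ (-((n : ℝ) + 1) - m' + 1) := by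
    rw [mul_zpow, mul_assoc]
    congr 1
    rw [← Real.rpow_intCast, ← Real.rpow_add h0]
    congr 1
    push_cast; ring
  calc _ ≤ (2 * π * ℏ) ^ (-((n : ℤ) + 1)) * (D * ℏ ^ (1 - m')) := by
        refine mul_le_mul_of_nonneg_left ?_ hpos.le
        simpa using hc
    _ = (2 * π) ^ (-((n : ℤ) + 1)) * D * ℏ ^ (-((n : ℝ) + 1) - m' + 1) := by
        linear_combination D * e3
    _ ≤ _ := by nlinarith
end
end

section
/- Let a be an amplitude of order m′ with m′ ≤ −2. Then, as ħ → 0⁺, ∫_{ℝ^n} u_ħ(x,x) dx = (2πħ)^{−n} · 2π · ∫_{ℝ^n × ℝ^{n−1} × ℝ} a(0, x, x, (μ,p′), ħ^{−1}μ) dx dp′ dμ + O(ħ^{−n+2}); that is, there are constants C > 0 and ħ₀ > 0 such that for all 0 < ħ ≤ ħ₀ the absolute value of the difference of the two sides is at most C ħ^{−n+2}. (Here (μ,p′) denotes the momentum variable p with first component p₁ = μ, and the argument σ of a is set equal to ħ^{−1}μ.) -/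
open MeasureTheory Real

noncomputable section

open scoped FourierTransform

lemma four_le : (4 : WithTop ℕ∞) ≤ ((⊤ : ℕ∞) : WithTop ℕ∞) := by
  exact WithTop.coe_le_coe.2 (le_top : (4 : ℕ∞) ≤ ⊤)

lemma iterDeriv_zero_out (f : ℝ → ℂ) (R : ℝ) (h : ∀ x, R < |x| → f x = 0) (k : ℕ) (x : ℝ)
    (hx : R < |x|) : iteratedDeriv k f x = 0 := by
  have : f =ᶠ[nhds x] (fun _ => (0:ℂ)) := by
    have ho : IsOpen {y : ℝ | R < |y|} := isOpen_lt continuous_const continuous_abs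
    filter_upwards [ho.mem_nhds hx] with y hy using h y hy
  rw [this.iteratedDeriv_eq]
  simp

lemma hcs_of_out (f : ℝ → ℂ) (R : ℝ) (h : ∀ x, R < |x| → f x = 0) : HasCompactSupport f := by
  refine HasCompactSupport.intro (isCompact_Icc (a := -R) (b := R)) ?_
  intro x hx
  apply h
  by_contra hc
  exact hx (by simpa [abs_le] using hc)

lemma int_norm_le (f : ℝ → ℂ) (R M : ℝ) (hR : 0 ≤ R) (h : ∀ x, R < |x| → f x = 0)
    (hM : ∀ x, ‖f x‖ ≤ M) : ∫ x, ‖f x‖ ≤ 2 * R * M := by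
  have : ∫ x, ‖f x‖ = ∫ x in Set.Icc (-R) R, ‖f x‖ := by
    symm
    apply setIntegral_eq_integral_of_forall_compl_eq_zero
    intro x hx
    rw [h x, norm_zero]
    by_contra hc
    exact hx (by simpa [abs_le] using hc)
  rw [this]
  have h2 := norm_setIntegral_le_of_norm_le_const (μ := volume) (s := Set.Icc (-R) R) (f := fun x => ‖f x‖) (C := M)
    (by simp) (fun x _ => by simpa using hM x)
  refine (le_abs_self _).trans (h2.trans (le_of_eq ?_))
  simp [Measure.real]
  rw [ENNReal.toReal_ofReal (by linarith)]
  ring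

lemma norm_fourier_le_int (f : ℝ → ℂ) (v : ℝ) : ‖𝓕 f v‖ ≤ ∫ x, ‖f x‖ := by
  rw [fourier_real_eq_integral_exp_smul]
  refine (norm_integral_le_integral_norm _).trans (le_of_eq ?_)
  congr 1
  ext x
  rw [norm_smul, Complex.norm_exp_ofReal_mul_I, one_mul]

lemma decay (f : ℝ → ℂ) (hf : ContDiff ℝ (⊤ : ℕ∞) f) (R M : ℝ) (hR : 0 ≤ R)
    (h : ∀ x, R < |x| → f x = 0) (hM : ∀ x, ‖f x‖ ≤ M) (hM4 : ∀ x, ‖iteratedDeriv 4 f x‖ ≤ M)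
    (v : ℝ) : ‖𝓕 f v‖ * (1 + v ^ 4) ≤ 4 * R * M := by
  have h1 := (norm_fourier_le_int f v).trans (int_norm_le f R M hR h hM)
  have h2 := (norm_fourier_le_int _ v).trans
    (int_norm_le _ R M hR (iterDeriv_zero_out f R h 4) hM4)
  rw [Real.fourier_iteratedDeriv (N := ⊤) (n := 4) hf ?_ le_top] at h2
  · simp only [norm_smul, norm_pow, norm_mul, Complex.norm_real, Complex.norm_I,
      RCLike.norm_ofNat, norm_eq_abs] at h2
    rw [abs_of_pos pi_pos] at h2
    have h3 : v ^ 4 ≤ (2 * π * 1 * |v|) ^ 4 := by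
      have : v ^ 4 = |v| ^ 4 := by rw [← abs_pow, abs_of_nonneg (by positivity)]
      rw [this]
      apply pow_le_pow_left₀ (abs_nonneg _)
      nlinarith [abs_nonneg v, pi_gt_three]
    nlinarith [norm_nonneg (𝓕 f v), mul_le_mul_of_nonneg_right h3 (norm_nonneg (𝓕 f v))]
  · intro k _
    exact (hf.continuous_iteratedDeriv k (by exact_mod_cast le_top)).integrable_of_hasCompactSupport
      (hcs_of_out _ R (iterDeriv_zero_out f R h k))

lemma aux_ineq (v : ℝ) : (1 + v ^ 4)⁻¹ ≤ 2 * (1 + v ^ 2)⁻¹ ∧ |v| * (1 + v ^ 4)⁻¹ ≤ 2 * (1 + v ^ 2)⁻¹ := by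
  have h4 : v ^ 4 = |v| ^ 4 := by rw [← abs_pow, abs_of_nonneg (by positivity)]
  have h2 : v ^ 2 = |v| ^ 2 := by simp
  rw [h4, h2]
  set t := |v|
  have ht : 0 ≤ t := abs_nonneg v
  constructor
  · rw [← div_eq_mul_inv, inv_eq_one_div, div_le_div_iff₀ (by positivity) (by positivity)]
    nlinarith [sq_nonneg (t^2-1)]
  · rw [← div_eq_mul_inv, ← div_eq_mul_inv, div_le_div_iff₀ (by positivity) (by positivity)]
    nlinarith [sq_nonneg (t^2-1), sq_nonneg (t-1), sq_nonneg (t^2-t)]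

lemma fourier_integrable (f : ℝ → ℂ) (hf : ContDiff ℝ (⊤ : ℕ∞) f) (R : ℝ) (hR : 0 ≤ R)
    (h : ∀ x, R < |x| → f x = 0) : Integrable (𝓕 f) := by
  obtain ⟨M0, hM0⟩ := (hcs_of_out f R h).exists_bound_of_continuous hf.continuous
  obtain ⟨M4, hM4⟩ := (hcs_of_out _ R (iterDeriv_zero_out f R h 4)).exists_bound_of_continuous
    (hf.continuous_iteratedDeriv 4 four_le)
  have hd := decay f hf R (max M0 M4) hR h (fun x => (hM0 x).trans (le_max_left _ _))
    (fun x => (hM4 x).trans (le_max_right _ _))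
  have hint : Integrable f := hf.continuous.integrable_of_hasCompactSupport (hcs_of_out f R h)
  have hc : Continuous (𝓕 f) := by
    exact VectorFourier.fourierIntegral_continuous Real.continuous_fourierChar
      (by exact continuous_inner) hint
  have hM : 0 ≤ max M0 M4 := (norm_nonneg _).trans ((hM0 0).trans (le_max_left _ _))
  refine Integrable.mono' ((integrable_inv_one_add_sq).const_mul (4 * R * max M0 M4 * 2))
    hc.aestronglyMeasurable (Filter.Eventually.of_forall fun v => ?_)
  have := hd v
  rw [← le_div_iff₀ (by positivity), div_eq_mul_inv] at this
  refine this.trans ?_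
  rw [mul_assoc _ 2]
  exact mul_le_mul_of_nonneg_left (aux_ineq v).1 (by positivity)

lemma key (g : ℝ → ℝ → ℂ) (hg : ContDiff ℝ (⊤ : ℕ∞) (fun q : ℝ × ℝ => g q.1 q.2)) (R B : ℝ) (hR : 0 ≤ R)
    (hB : 0 ≤ B) (hs : ∀ s μ, R < |s| → g s μ = 0) (hμ : ∀ s μ, R < |μ| → g s μ = 0)
    (h0 : ∀ s μ, ‖g s μ - g 0 μ‖ ≤ B * |s|)
    (h4 : ∀ s μ, ‖iteratedDeriv 4 (g s) μ - iteratedDeriv 4 (g 0) μ‖ ≤ B * |s|)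
    (ℏ σ : ℝ) (hh : 0 < ℏ) :
    ‖(∫ q : ℝ × ℝ, Complex.exp (Complex.I * Complex.ofReal (q.1 * σ - ℏ⁻¹ * q.1 * q.2)) * g q.1 q.2)
      - Complex.ofReal (2 * π * ℏ) * g 0 (ℏ * σ)‖ ≤ 32 * R * π ^ 3 * B * ℏ ^ 2 := by
  have hgs : ∀ s, ContDiff ℝ (⊤ : ℕ∞) (g s) := fun s =>
    hg.comp (contDiff_const.prodMk contDiff_id)
  have hcont : Continuous (fun q : ℝ × ℝ => g q.1 q.2) := hg.continuous
  have hI : Integrable (fun q : ℝ × ℝ =>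
      Complex.exp (Complex.I * Complex.ofReal (q.1 * σ - ℏ⁻¹ * q.1 * q.2)) * g q.1 q.2)
      (volume.prod volume) := by
    apply Continuous.integrable_of_hasCompactSupport
    · fun_prop
    · refine HasCompactSupport.intro ((isCompact_Icc (a := -R) (b := R)).prod
        (isCompact_Icc (a := -R) (b := R))) ?_
      rintro ⟨s, μ⟩ hq
      have : g s μ = 0 := by
        by_contra hne
        apply hq
        simp only [Set.mem_prod, Set.mem_Icc, ← abs_le]
        exact ⟨not_lt.1 fun h => hne (hs s μ h), not_lt.1 fun h => hne (hμ s μ h)⟩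
      simp [this]
  set c : ℝ := 2 * π * ℏ with hc
  have hcpos : 0 < c := by positivity
  let H : ℝ → ℂ := fun s => ∫ μ, Complex.exp (Complex.I * Complex.ofReal (s * σ - ℏ⁻¹ * s * μ)) * g s μ
  have hH : Integrable H := hI.integral_prod_left
  have hHc : ∀ v, H (c * v) = Complex.exp (Complex.ofReal (2 * π * (v * (ℏ * σ))) * Complex.I) * 𝓕 (g (c * v)) v := by
    intro v
    simp only [H]
    rw [fourier_real_eq_integral_exp_smul, ← integral_const_mul]
    congr 1
    ext μ
    rw [smul_eq_mul, ← mul_assoc (Complex.exp _) (Complex.exp _), ← Complex.exp_add]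
    congr 2
    rw [← add_mul, ← Complex.ofReal_add, mul_comm Complex.I]
    congr 2
    rw [hc]; field_simp; ring
  have e1 : (∫ q : ℝ × ℝ, Complex.exp (Complex.I * Complex.ofReal (q.1 * σ - ℏ⁻¹ * q.1 * q.2)) * g q.1 q.2)
      = Complex.ofReal c * ∫ v, H (c * v) := by
    rw [Measure.integral_comp_mul_left H c, abs_of_pos (by positivity), Complex.real_smul, ← mul_assoc,
      ← Complex.ofReal_mul, mul_inv_cancel₀ hcpos.ne', Complex.ofReal_one, one_mul]
    exact integral_prod _ hI
  have hF0 : Integrable (𝓕 (g 0)) := fourier_integrable _ (hgs 0) R hR (hμ 0)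
  have hg0 : Integrable (g 0) :=
    (hgs 0).continuous.integrable_of_hasCompactSupport (hcs_of_out _ R (hμ 0))
  have e2 : g 0 (ℏ * σ) = ∫ v, Complex.exp (Complex.ofReal (2 * π * (v * (ℏ * σ))) * Complex.I) * 𝓕 (g 0) v := by
    have := congrFun ((hgs 0).continuous.fourierInv_fourier_eq hg0 hF0) (ℏ * σ)
    rw [← this, fourierInv_eq']
    congr 1
    ext v
    simp [mul_comm]
  have i2 : Integrable (fun v => Complex.exp (Complex.ofReal (2 * π * (v * (ℏ * σ))) * Complex.I) * 𝓕 (g 0) v) := by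
    refine hF0.bdd_mul (c := 1) (Continuous.aestronglyMeasurable (by fun_prop)) ?_
    refine Filter.Eventually.of_forall fun v => ?_
    rw [Complex.norm_exp_ofReal_mul_I]
  rw [e1, e2, ← mul_sub, ← integral_sub (hH.comp_mul_left' hcpos.ne') i2, norm_mul,
    Complex.norm_real, norm_eq_abs, abs_of_pos hcpos]
  have hb : ∀ v, ‖H (c * v) - Complex.exp (Complex.ofReal (2 * π * (v * (ℏ * σ))) * Complex.I) * 𝓕 (g 0) v‖
      ≤ (4 * R * (B * c)) * 2 * (1 + v ^ 2)⁻¹ := by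
    intro v
    rw [hHc, ← mul_sub, norm_mul, Complex.norm_exp_ofReal_mul_I, one_mul]
    have hgc : Integrable (g (c * v)) :=
      (hgs _).continuous.integrable_of_hasCompactSupport (hcs_of_out _ R (hμ _))
    have e3 : 𝓕 (g (c * v)) v - 𝓕 (g 0) v = 𝓕 (g (c * v) - g 0) v := by
      rw [Real.fourier_eq, Real.fourier_eq, Real.fourier_eq, ← integral_sub]
      · congr 1; ext x; simp [smul_sub]
      · exact (Real.fourierIntegral_convergent_iff v).2 hgc
      · exact (Real.fourierIntegral_convergent_iff v).2 hg0
    rw [e3]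
    have := decay (g (c * v) - g 0) ((hgs _).sub (hgs _)) R (B * |c * v|) hR
      (fun x hx => by simp [hμ _ x hx]) (fun x => h0 _ x) (fun x => by
        have := h4 (c * v) x
        rwa [iteratedDeriv_sub]
        · exact (hgs _).contDiffAt.of_le four_le
        · exact (hgs _).contDiffAt.of_le four_le) v
    rw [← le_div_iff₀ (by positivity), div_eq_mul_inv, abs_mul, abs_of_pos hcpos] at this
    refine this.trans ?_
    calc 4 * R * (B * (c * |v|)) * (1 + v ^ 4)⁻¹ = (4 * R * (B * c)) * (|v| * (1 + v ^ 4)⁻¹) := by ring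
      _ ≤ (4 * R * (B * c)) * (2 * (1 + v ^ 2)⁻¹) :=
        mul_le_mul_of_nonneg_left (aux_ineq v).2 (by positivity)
      _ = _ := by ring
  have := norm_integral_le_of_norm_le (integrable_inv_one_add_sq.const_mul (4 * R * (B * c) * 2))
    (Filter.Eventually.of_forall hb)
  rw [integral_const_mul, integral_univ_inv_one_add_sq] at this
  calc _ ≤ c * (4 * R * (B * c) * 2 * π) := mul_le_mul_of_nonneg_left this hcpos.le
    _ = _ := by rw [hc]; ring

lemma iterDeriv_line {W : Type*} [NormedAddCommGroup W] [NormedSpace ℝ W] (F : W → ℂ)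
    (hF : ContDiff ℝ (⊤ : ℕ∞) F) (w e : W) (k : ℕ) (μ : ℝ) :
    iteratedDeriv k (fun μ : ℝ => F (w + μ • e)) μ
      = iteratedFDeriv ℝ k F (w + μ • e) (fun _ => e) := by
  let L : ℝ →L[ℝ] W := (ContinuousLinearMap.id ℝ ℝ).smulRight e
  have h1 : (fun μ : ℝ => F (w + μ • e)) = (fun v => F (w + v)) ∘ L := by
    ext μ; simp [L]
  have hG : ContDiff ℝ (⊤ : ℕ∞) (fun v => F (w + v)) := hF.comp (contDiff_const.add contDiff_id)
  rw [iteratedDeriv_eq_iteratedFDeriv, h1, L.iteratedFDeriv_comp_right hG μ (by exact_mod_cast le_top),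
    iteratedFDeriv_comp_add_left]
  simp [L]

lemma line_lip {W : Type*} [NormedAddCommGroup W] [NormedSpace ℝ W] (F : W → ℂ)
    (hF : ContDiff ℝ (⊤ : ℕ∞) F) (w₁ w₂ e : W) (he : ‖e‖ ≤ 1) (k : ℕ) (C : ℝ)
    (hC : ∀ w, ‖iteratedFDeriv ℝ (k+1) F w‖ ≤ C) (μ : ℝ) :
    ‖iteratedDeriv k (fun μ : ℝ => F (w₁ + μ • e)) μ
      - iteratedDeriv k (fun μ : ℝ => F (w₂ + μ • e)) μ‖ ≤ C * ‖w₁ - w₂‖ := by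
  rw [iterDeriv_line F hF, iterDeriv_line F hF, ← sub_apply]
  refine (ContinuousMultilinearMap.le_opNorm _ _).trans ?_
  have hl : ‖iteratedFDeriv ℝ k F (w₁ + μ • e) - iteratedFDeriv ℝ k F (w₂ + μ • e)‖
      ≤ C * ‖(w₁ + μ • e) - (w₂ + μ • e)‖ := by
    apply convex_univ.norm_image_sub_le_of_norm_fderiv_le (𝕜 := ℝ) _ _ (Set.mem_univ _) (Set.mem_univ _)
    · intro w _
      have hd : Differentiable ℝ (iteratedFDeriv ℝ k F) :=
        hF.differentiable_iteratedFDeriv (by exact_mod_cast WithTop.coe_lt_top k)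
      exact hd w
    · intro w _
      rw [norm_fderiv_iteratedFDeriv]
      exact hC w
  rw [add_sub_add_right_eq_sub] at hl
  have hp : ∏ _i : Fin k, ‖e‖ ≤ 1 := Finset.prod_le_one (fun _ _ => norm_nonneg _) (fun _ _ => he)
  calc _ ≤ ‖iteratedFDeriv ℝ k F (w₁ + μ • e) - iteratedFDeriv ℝ k F (w₂ + μ • e)‖ * 1 :=
        mul_le_mul_of_nonneg_left hp (norm_nonneg _)
    _ ≤ _ := by rw [mul_one]; exact hl

lemma cons_line (n : ℕ) (p' : Fin n → ℝ) (μ : ℝ) :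
    (Fin.cons μ p' : Fin (n+1) → ℝ) = Fin.cons 0 p' + μ • (Fin.cons 1 0 : Fin (n+1) → ℝ) := by
  ext i
  refine Fin.cases ?_ (fun j => ?_) i <;> simp

lemma mp_T (n : ℕ) : MeasurePreserving
    (fun z : ((Fin (n+1) → ℝ) × (Fin n → ℝ) × ℝ) × (ℝ × ℝ) =>
      ((z.1.1, z.2.1, Fin.cons z.2.2 z.1.2.1, z.1.2.2) :
        (Fin (n+1) → ℝ) × (ℝ × (Fin (n+1) → ℝ) × ℝ))) := by
  have hcons : MeasurePreserving (fun q : ℝ × (Fin n → ℝ) => (Fin.cons q.1 q.2 : Fin (n+1) → ℝ)) := by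
    have := (volume_preserving_piFinSuccAbove (fun _ : Fin (n+1) => ℝ) 0).symm
    convert this using 1
    ext q i
    refine Fin.cases ?_ (fun j => ?_) i <;> simp [MeasurableEquiv.piFinSuccAbove]
  have a1 : MeasurePreserving (fun q : ℝ × (Fin n → ℝ) × ℝ => ((q.1, q.2.1), q.2.2)) :=
    (volume_preserving_prodAssoc (α₁ := ℝ) (β₁ := Fin n → ℝ) (γ₁ := ℝ)).symm
  have a2 : MeasurePreserving (fun q : ℝ × (Fin n → ℝ) × ℝ => ((Fin.cons q.1 q.2.1 : Fin (n+1) → ℝ), q.2.2)) :=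
    (hcons.prod (MeasurePreserving.id (volume : Measure ℝ))).comp a1
  have a3 : MeasurePreserving (fun q : (ℝ × ℝ) × ((Fin n → ℝ) × ℝ) => (q.1.1, (q.1.2, q.2))) :=
    volume_preserving_prodAssoc
  have a4 : MeasurePreserving (fun q : ((Fin n → ℝ) × ℝ) × (ℝ × ℝ) => (q.2, q.1)) :=
    Measure.measurePreserving_swap
  have a5 : MeasurePreserving (fun q : ((Fin n → ℝ) × ℝ) × (ℝ × ℝ) =>
      (q.2.1, ((Fin.cons q.2.2 q.1.1 : Fin (n+1) → ℝ), q.1.2))) :=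
    ((MeasurePreserving.id (volume : Measure ℝ)).prod a2).comp (a3.comp a4)
  have a6 : MeasurePreserving (fun q : ((Fin (n+1) → ℝ) × ((Fin n → ℝ) × ℝ)) × (ℝ × ℝ) =>
      (q.1.1, (q.1.2, q.2))) := volume_preserving_prodAssoc
  exact ((MeasurePreserving.id (volume : Measure (Fin (n+1) → ℝ))).prod a5).comp a6

lemma amp_bound (n : ℕ) (m' : ℝ)
    (a : (ℝ × (Fin (n+1) → ℝ) × (Fin (n+1) → ℝ) × (Fin (n+1) → ℝ)) → ℝ → ℂ)
    (ha : IsAmplitude n m' a) (hm : m' ≤ -2) (k : ℕ) :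
    ∃ C ≥ (0:ℝ), ∀ w σ, ‖iteratedFDeriv ℝ k (fun w' => a w' σ) w‖ ≤ C * (1 + σ ^ 2)⁻¹ := by
  obtain ⟨C, hC⟩ := ha.2.2 k 0
  refine ⟨|C|, abs_nonneg _, fun w σ => ?_⟩
  have h := hC w σ
  simp only [iteratedDeriv_zero] at h
  refine h.trans ?_
  have h1 : (1 + |σ|) ^ (m' - ((0:ℕ) : ℝ)) ≤ (1 + σ ^ 2)⁻¹ := by
    calc (1 + |σ|) ^ (m' - ((0:ℕ) : ℝ)) ≤ (1 + |σ|) ^ (-2 : ℝ) :=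
          Real.rpow_le_rpow_of_exponent_le (by linarith [abs_nonneg σ]) (by simpa using hm)
      _ = ((1 + |σ|) ^ 2)⁻¹ := by
          rw [Real.rpow_neg (by positivity)]; norm_cast
      _ ≤ _ := by
          apply inv_anti₀ (by positivity)
          nlinarith [abs_nonneg σ, sq_abs σ]
  calc _ ≤ |C| * (1 + |σ|) ^ (m' - ((0:ℕ) : ℝ)) :=
        mul_le_mul_of_nonneg_right (le_abs_self C) (by positivity)
    _ ≤ _ := mul_le_mul_of_nonneg_left h1 (abs_nonneg _)

def chi {E : Type*} [SeminormedAddCommGroup E] (R : ℝ) (x : E) : ℝ :=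
  (Metric.closedBall (0 : E) R).indicator (fun _ => (1 : ℝ)) x

lemma chi_nonneg {E : Type*} [SeminormedAddCommGroup E] (R : ℝ) (x : E) : 0 ≤ chi R x :=
  Set.indicator_nonneg (fun _ _ => zero_le_one) x

lemma chi_one {E : Type*} [SeminormedAddCommGroup E] (R : ℝ) (x : E) (h : ‖x‖ ≤ R) : chi R x = 1 := by
  simp [chi, h]

lemma chi_integrable {E : Type*} [NormedAddCommGroup E] [ProperSpace E] [MeasureSpace E]
    [OpensMeasurableSpace E] [IsFiniteMeasureOnCompacts (volume : Measure E)] (R : ℝ) :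
    Integrable (chi R : E → ℝ) := by
  unfold chi
  rw [integrable_indicator_iff Metric.isClosed_closedBall.measurableSet]
  exact integrableOn_const (isCompact_closedBall (0 : E) R).measure_lt_top.ne

def bnd (n : ℕ) (R : ℝ) (z : (Fin (n+1) → ℝ) × (Fin n → ℝ) × ℝ) : ℝ :=
  chi R z.1 * (chi R z.2.1 * (1 + z.2.2 ^ 2)⁻¹)

lemma bnd_nonneg (n : ℕ) (R : ℝ) (z) : 0 ≤ bnd n R z :=
  mul_nonneg (chi_nonneg _ _) (mul_nonneg (chi_nonneg _ _) (by positivity))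

lemma bnd_integrable (n : ℕ) (R : ℝ) : Integrable (bnd n R) :=
  (chi_integrable R).mul_prod ((chi_integrable R).mul_prod integrable_inv_one_add_sq)

lemma cont_cons (n : ℕ) : Continuous (fun q : ℝ × (Fin n → ℝ) => (Fin.cons q.1 q.2 : Fin (n+1) → ℝ)) := by
  refine continuous_pi fun i => ?_
  refine Fin.cases ?_ (fun j => ?_) i
  · simpa using continuous_fst
  · simp only [Fin.cons_succ]; fun_prop

lemma change_var (n : ℕ) (f : (Fin (n+1) → ℝ) × (Fin n → ℝ) × ℝ → ℂ) (ℏ : ℝ) (hh : 0 < ℏ)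
    (hf : Integrable f) (hf' : Integrable fun z : (Fin (n+1) → ℝ) × (Fin n → ℝ) × ℝ => f (z.1, z.2.1, ℏ * z.2.2)) :
    ∫ z, f z = (ℏ : ℂ) * ∫ z : (Fin (n+1) → ℝ) × (Fin n → ℝ) × ℝ, f (z.1, z.2.1, ℏ * z.2.2) := by
  have a1 : ∀ (X Y : Type) [MeasureSpace X] [MeasureSpace Y] [SFinite (volume : Measure X)]
      [SFinite (volume : Measure Y)] (g : X × Y × ℝ → ℂ), Integrable g →
      ∫ z, g z = ∫ w : X × Y, ∫ t : ℝ, g (w.1, w.2, t) := by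
    intro X Y _ _ _ _ g hg
    have hmp := volume_preserving_prodAssoc (α₁ := X) (β₁ := Y) (γ₁ := ℝ)
    rw [← hmp.integral_comp' g]
    have : Integrable (fun q : (X × Y) × ℝ => g (MeasurableEquiv.prodAssoc q)) :=
      hmp.integrable_comp_of_integrable hg
    exact integral_prod _ this
  rw [a1 _ _ f hf, a1 _ _ _ hf', ← integral_const_mul]
  congr 1
  ext w
  rw [Measure.integral_comp_mul_left (fun t => f (w.1, w.2, t)) ℏ, abs_of_pos (by positivity),
    Complex.real_smul, ← mul_assoc, ← Complex.ofReal_mul, mul_inv_cancel₀ hh.ne',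
    Complex.ofReal_one, one_mul]

/-- trace asymptotics, `m' ≤ -2`: as `ℏ → 0⁺`,
`∫ u_ℏ(x,x) dx = (2πℏ)^{-(n+1)} · 2π · ∫ a(0,x,x,(μ,p'),ℏ⁻¹μ) dx dp' dμ + O(ℏ^{-(n+1)+2})`. -/
theorem statement4 (n : ℕ) (m' : ℝ)
    (a : (ℝ × (Fin (n+1) → ℝ) × (Fin (n+1) → ℝ) × (Fin (n+1) → ℝ)) → ℝ → ℂ)
    (ha : IsAmplitude n m' a) (hm : m' ≤ -2) :
    ∃ C > (0 : ℝ), ∃ ℏ₀ > (0 : ℝ), ∀ ℏ : ℝ, 0 < ℏ → ℏ ≤ ℏ₀ →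
      ‖(∫ x : Fin (n+1) → ℝ, uh n m' a ℏ x x) -
          Complex.ofReal ((2 * π * ℏ) ^ (-((n : ℤ) + 1)) * (2 * π)) *
            ∫ q : (Fin (n+1) → ℝ) × (Fin n → ℝ) × ℝ,
              a (0, q.1, q.1, Fin.cons q.2.2 q.2.1) (ℏ⁻¹ * q.2.2)‖
        ≤ C * ℏ ^ (-((n : ℝ) + 1) + 2) := by
  obtain ⟨hsm, ⟨K, hK, hK0⟩, _⟩ := id ha
  obtain ⟨R0, hR0⟩ := hK.isBounded.exists_norm_le
  obtain ⟨R, hR, hRK⟩ : ∃ R ≥ (0:ℝ), ∀ w σ, R < ‖w‖ → a w σ = 0 := by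
    refine ⟨max R0 0, le_max_right _ _, fun w σ hw => hK0 w σ fun hwK => ?_⟩
    exact absurd ((hR0 w hwK).trans (le_max_left _ _)) (not_le.2 hw)
  obtain ⟨C0, hC0, hb0⟩ := amp_bound n m' a ha hm 0
  obtain ⟨C1, hC1, hb1⟩ := amp_bound n m' a ha hm 1
  obtain ⟨C5, hC5, hb5⟩ := amp_bound n m' a ha hm 5
  have hsup : ∀ s (x : Fin (n+1) → ℝ) μ (p' : Fin n → ℝ) σ, a (s, x, x, Fin.cons μ p') σ ≠ 0 →
      |s| ≤ R ∧ ‖x‖ ≤ R ∧ |μ| ≤ R ∧ ‖p'‖ ≤ R := by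
    intro s x μ p' σ hne
    have hw : ‖(s, x, x, (Fin.cons μ p' : Fin (n+1) → ℝ))‖ ≤ R := not_lt.1 fun h => hne (hRK _ _ h)
    simp only [Prod.norm_def, sup_le_iff, norm_eq_abs] at hw
    obtain ⟨h1, h2, -, h4⟩ := hw
    rw [pi_norm_le_iff_of_nonneg hR] at h4
    refine ⟨h1, h2, by simpa using h4 0, ?_⟩
    rw [pi_norm_le_iff_of_nonneg hR]
    intro i
    simpa using h4 i.succ
  have hsmσ : ∀ σ, ContDiff ℝ (⊤ : ℕ∞) (fun w => a w σ) := fun σ =>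
    hsm.comp (contDiff_id.prodMk contDiff_const)
  have hcont : Continuous (fun q : (ℝ × (Fin (n+1) → ℝ) × (Fin (n+1) → ℝ) × (Fin (n+1) → ℝ)) × ℝ => a q.1 q.2) :=
    hsm.continuous
  have hna : ∀ w σ, ‖a w σ‖ ≤ C0 * (1 + σ ^ 2)⁻¹ := fun w σ => by simpa using hb0 w σ
  set A := C1 + C5 with hA
  -- pointwise estimate
  have hkey : ∀ ℏ : ℝ, 0 < ℏ → ∀ z : (Fin (n+1) → ℝ) × (Fin n → ℝ) × ℝ,
      ‖(∫ q : ℝ × ℝ, Complex.exp (Complex.I * Complex.ofReal (q.1 * z.2.2 - ℏ⁻¹ * q.1 * q.2)) *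
          a (q.1, z.1, z.1, Fin.cons q.2 z.2.1) z.2.2)
        - Complex.ofReal (2 * π * ℏ) * a (0, z.1, z.1, Fin.cons (ℏ * z.2.2) z.2.1) z.2.2‖
      ≤ 32 * R * π ^ 3 * A * ℏ ^ 2 * bnd n R z := by
    rintro ℏ hh ⟨x, p', σ⟩
    by_cases hxp : ‖x‖ ≤ R ∧ ‖p'‖ ≤ R
    · have hbz : bnd n R (x, p', σ) = (1 + σ ^ 2)⁻¹ := by
        simp [bnd, chi_one R x hxp.1, chi_one R p' hxp.2]
      rw [hbz]
      let e : ℝ × (Fin (n+1) → ℝ) × (Fin (n+1) → ℝ) × (Fin (n+1) → ℝ) := (0, 0, 0, Fin.cons 1 0)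
      have he : ‖e‖ ≤ 1 := by
        simp only [e, Prod.norm_def, sup_le_iff]
        refine ⟨by simp, by simp, by simp, ?_⟩
        rw [pi_norm_le_iff_of_nonneg zero_le_one]
        intro i
        refine Fin.cases ?_ (fun j => ?_) i <;> simp
      have hline : ∀ s μ : ℝ, a (s, x, x, Fin.cons μ p') σ
          = a ((s, x, x, Fin.cons 0 p') + μ • e) σ := by
        intro s μ
        simp only [e, Prod.smul_mk, Prod.mk_add_mk, smul_zero, add_zero, ← cons_line]
      have hwn : ∀ s : ℝ, ‖((s, x, x, Fin.cons 0 p') : ℝ × (Fin (n+1) → ℝ) × (Fin (n+1) → ℝ) × (Fin (n+1) → ℝ))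
          - (0, x, x, Fin.cons 0 p')‖ = |s| := by
        intro s
        simp [Prod.norm_def]
      have hmono : ∀ C, 0 ≤ C → C ≤ A → ∀ s : ℝ, C * (1 + σ ^ 2)⁻¹ * |s| ≤ A * (1 + σ ^ 2)⁻¹ * |s| := by
        intro C _ hCA s
        gcongr
      have := key (fun s μ => a (s, x, x, Fin.cons μ p') σ) (by
          simp only [hline, e, Prod.smul_mk, Prod.mk_add_mk, smul_zero, add_zero]
          refine (hsmσ σ).comp ?_
          fun_prop) R (A * (1 + σ ^ 2)⁻¹) hR (by positivity)
        (fun s μ h => by_contra fun hne => absurd (hsup _ _ _ _ _ hne).1 (not_le.2 h))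
        (fun s μ h => by_contra fun hne => absurd (hsup _ _ _ _ _ hne).2.2.1 (not_le.2 h))
        (fun s μ => by
          have := line_lip _ (hsmσ σ) (s, x, x, Fin.cons 0 p') (0, x, x, Fin.cons 0 p') e he 0 _
            (fun w => hb1 w σ) μ
          rw [hwn] at this
          simp only [iteratedDeriv_zero, ← hline] at this
          exact this.trans (hmono _ hC1 (by linarith) s))
        (fun s μ => by
          have := line_lip _ (hsmσ σ) (s, x, x, Fin.cons 0 p') (0, x, x, Fin.cons 0 p') e he 4 _
            (fun w => hb5 w σ) μ
          rw [hwn] at this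
          simp only [← hline] at this
          exact this.trans (hmono _ hC5 (by linarith) s)) ℏ σ hh
      refine this.trans (le_of_eq ?_)
      ring
    · have hz : ∀ s μ, a (s, x, x, Fin.cons μ p') σ = 0 := fun s μ => by_contra fun hne =>
        hxp ⟨(hsup _ _ _ _ _ hne).2.1, (hsup _ _ _ _ _ hne).2.2.2⟩
      simp only [hz, mul_zero, integral_zero, sub_zero, norm_zero]
      have := bnd_nonneg n R (x, p', σ)
      positivity
  -- the constant
  have hbI : 0 ≤ ∫ z, bnd n R z := integral_nonneg (bnd_nonneg n R)
  refine ⟨(2 * π) ^ (-((n : ℤ) + 1)) * (32 * R * π ^ 3 * A * ∫ z, bnd n R z) + 1, by positivity,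
    1, one_pos, ?_⟩
  intro ℏ hh _
  have hmain := hkey ℏ hh
  let Φ : ((Fin (n+1) → ℝ) × (Fin n → ℝ) × ℝ) × (ℝ × ℝ) → ℂ := fun z =>
    Complex.exp (Complex.I * Complex.ofReal (z.2.1 * z.1.2.2 - ℏ⁻¹ * z.2.1 * z.2.2)) *
          a (z.2.1, z.1.1, z.1.1, Fin.cons z.2.2 z.1.2.1) z.1.2.2
  let Ψ : (Fin (n+1) → ℝ) × (ℝ × (Fin (n+1) → ℝ) × ℝ) → ℂ := fun z =>
    Complex.exp (Complex.I * Complex.ofReal (z.2.1 * z.2.2.2 - ℏ⁻¹ * z.2.1 * z.2.2.1 0)) *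
          a (z.2.1, z.1, z.1, z.2.2.1) z.2.2.2
  have hΨc : Continuous Ψ := by
    refine Continuous.mul (by fun_prop) ?_
    exact hcont.comp (by fun_prop :
      Continuous (fun z : (Fin (n+1) → ℝ) × (ℝ × (Fin (n+1) → ℝ) × ℝ) => ((z.2.1, z.1, z.1, z.2.2.1), z.2.2.2)))
  have hT := mp_T n
  have hΦΨ : Φ = Ψ ∘ (fun z : ((Fin (n+1) → ℝ) × (Fin n → ℝ) × ℝ) × (ℝ × ℝ) =>
      ((z.1.1, z.2.1, Fin.cons z.2.2 z.1.2.1, z.1.2.2) :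
        (Fin (n+1) → ℝ) × (ℝ × (Fin (n+1) → ℝ) × ℝ))) := by
    ext z; simp [Φ, Ψ]
  have hΦm : AEStronglyMeasurable Φ (volume : Measure _) := by
    rw [hΦΨ]
    exact hΨc.aestronglyMeasurable.comp_measurePreserving hT
  have hΦi : Integrable Φ := by
    have hB : Integrable (fun z : ((Fin (n+1) → ℝ) × (Fin n → ℝ) × ℝ) × (ℝ × ℝ) =>
        C0 * (bnd n R z.1 * (chi R z.2.1 * chi R z.2.2))) :=
      ((bnd_integrable n R).mul_prod ((chi_integrable R).mul_prod (chi_integrable R))).const_mul C0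
    refine hB.mono' hΦm (Filter.Eventually.of_forall ?_)
    rintro ⟨⟨x, p', σ⟩, s, μ⟩
    simp only [Φ]
    rw [norm_mul, mul_comm Complex.I, Complex.norm_exp_ofReal_mul_I, one_mul]
    by_cases hne : a (s, x, x, Fin.cons μ p') σ = 0
    · rw [hne, norm_zero]
      exact mul_nonneg hC0 (mul_nonneg (bnd_nonneg _ _ _) (mul_nonneg (chi_nonneg _ _) (chi_nonneg _ _)))
    · obtain ⟨h1, h2, h3, h4⟩ := hsup _ _ _ _ _ hne
      rw [chi_one R s h1, chi_one R μ h3]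
      simpa [bnd, chi_one R x h2, chi_one R p' h4] using hna _ σ
  have hΨi : Integrable Ψ := by
    rw [hΦΨ] at hΦi
    exact (hT.integrable_comp hΨc.aestronglyMeasurable).1 hΦi
  have hK : ⌈m' / 2 + 1⌉₊ = 0 := Nat.ceil_eq_zero.2 (by linarith)
  have hL : ∫ x : Fin (n+1) → ℝ, uh n m' a ℏ x x
      = Complex.ofReal ((2 * π * ℏ) ^ (-((n : ℤ) + 1))) * ∫ z, ∫ t, Φ (z, t) := by
    have e1 : ∫ z, ∫ t, Φ (z, t) = ∫ z, Φ z := (integral_prod _ hΦi).symm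
    have e2 : ∫ z, Φ z = ∫ z, Ψ z := by
      rw [hΦΨ]
      conv_rhs => rw [← hT.map_eq]
      exact (integral_map hT.measurable.aemeasurable hΨc.aestronglyMeasurable).symm
    have e3 : ∫ z, Ψ z = ∫ x, ∫ q, Ψ (x, q) := integral_prod _ hΨi
    rw [e1, e2, e3, ← integral_const_mul]
    congr 1
    ext x
    unfold uh
    rw [hK]
    congr 2
    ext q
    simp only [oscIntegrand, Ψ, pow_zero, mul_one, Function.iterate_zero, id_eq, sub_self, zero_mul,
      Finset.sum_const_zero, mul_zero, zero_add]
    rw [← mul_assoc, ← Complex.exp_add]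
    congr 2
    push_cast
    ring
  -- the right-hand side
  let f : (Fin (n+1) → ℝ) × (Fin n → ℝ) × ℝ → ℂ := fun q =>
    a (0, q.1, q.1, Fin.cons q.2.2 q.2.1) (ℏ⁻¹ * q.2.2)
  have hconsc : Continuous (fun q : (Fin (n+1) → ℝ) × (Fin n → ℝ) × ℝ => (Fin.cons q.2.2 q.2.1 : Fin (n+1) → ℝ)) :=
    (cont_cons n).comp (by fun_prop : Continuous fun q : (Fin (n+1) → ℝ) × (Fin n → ℝ) × ℝ => (q.2.2, q.2.1))
  have hfc : Continuous f := by
    exact hcont.comp (by fun_prop : Continuous fun q : (Fin (n+1) → ℝ) × (Fin n → ℝ) × ℝ =>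
      (((0:ℝ), q.1, q.1, (Fin.cons q.2.2 q.2.1 : Fin (n+1) → ℝ)), ℏ⁻¹ * q.2.2))
  have hfs : HasCompactSupport f := by
    refine HasCompactSupport.intro (isCompact_closedBall (0 : (Fin (n+1) → ℝ) × (Fin n → ℝ) × ℝ) R) ?_
    rintro ⟨x, p', μ⟩ hq
    by_contra hne
    apply hq
    obtain ⟨_, h2, h3, h4⟩ := hsup _ _ _ _ _ hne
    simp only [mem_closedBall_zero_iff, Prod.norm_def, sup_le_iff, norm_eq_abs]
    exact ⟨h2, h4, h3⟩
  have hfi : Integrable f := hfc.integrable_of_hasCompactSupport hfs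
  let f' : (Fin (n+1) → ℝ) × (Fin n → ℝ) × ℝ → ℂ := fun z => f (z.1, z.2.1, ℏ * z.2.2)
  have hf'e : ∀ z, f' z = a (0, z.1, z.1, Fin.cons (ℏ * z.2.2) z.2.1) z.2.2 := by
    intro z
    simp only [f', f]
    rw [inv_mul_cancel_left₀ hh.ne']
  have hf'c : Continuous f' := hfc.comp (by fun_prop)
  have hf'i : Integrable f' := by
    refine ((bnd_integrable n R).const_mul C0).mono' hf'c.aestronglyMeasurable
      (Filter.Eventually.of_forall ?_)
    rintro ⟨x, p', σ⟩
    rw [hf'e]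
    by_cases hne : a (0, x, x, Fin.cons (ℏ * σ) p') σ = 0
    · simp only [hne, norm_zero]
      exact mul_nonneg hC0 (bnd_nonneg _ _ _)
    · obtain ⟨h1, h2, h3, h4⟩ := hsup _ _ _ _ _ hne
      simpa [bnd, chi_one R x h2, chi_one R p' h4] using hna _ σ
  have hcv : ∫ z, f z = (ℏ : ℂ) * ∫ z, f' z := change_var n f ℏ hh hfi hf'i
  have hJ : Integrable (fun z => ∫ t, Φ (z, t)) := hΦi.integral_prod_left
  have hdiff : (∫ x : Fin (n+1) → ℝ, uh n m' a ℏ x x) -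
          Complex.ofReal ((2 * π * ℏ) ^ (-((n : ℤ) + 1)) * (2 * π)) * ∫ q, f q
      = Complex.ofReal ((2 * π * ℏ) ^ (-((n : ℤ) + 1))) *
        ∫ z, ((∫ t, Φ (z, t)) - Complex.ofReal (2 * π * ℏ) * f' z) := by
    rw [hL, hcv, integral_sub hJ (hf'i.const_mul _), integral_const_mul, mul_sub]
    push_cast
    ring
  change ‖(∫ x : Fin (n+1) → ℝ, uh n m' a ℏ x x) -
          Complex.ofReal ((2 * π * ℏ) ^ (-((n : ℤ) + 1)) * (2 * π)) * ∫ q, f q‖ ≤ _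
  rw [hdiff, norm_mul, Complex.norm_real, norm_eq_abs, abs_of_pos (by positivity)]
  have hest : ‖∫ z, ((∫ t, Φ (z, t)) - Complex.ofReal (2 * π * ℏ) * f' z)‖
      ≤ ∫ z, 32 * R * π ^ 3 * A * ℏ ^ 2 * bnd n R z :=
    norm_integral_le_of_norm_le ((bnd_integrable n R).const_mul (32 * R * π ^ 3 * A * ℏ ^ 2))
      (Filter.Eventually.of_forall fun z => by rw [hf'e z]; exact hmain z)
  rw [integral_const_mul] at hest
  have hpow : ℏ ^ (-((n : ℝ) + 1) + 2) = ℏ ^ (-((n : ℤ) + 1)) * ℏ ^ 2 := by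
    rw [Real.rpow_add hh, ← Real.rpow_intCast, ← Real.rpow_natCast]
    push_cast
    rfl
  rw [hpow, mul_zpow]
  refine (mul_le_mul_of_nonneg_left hest (by positivity)).trans ?_
  have hpos : 0 ≤ ℏ ^ (-((n : ℤ) + 1)) * ℏ ^ 2 := by positivity
  rw [add_mul, one_mul]
  refine le_trans (le_of_eq ?_) (le_add_of_nonneg_right hpos)
  ring
end
end
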